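/- arXiv:2011.00465 — 2 statements merged into one kernel-verified Lean document; each statement's English description precedes it below -/
import Mathlib

section
/- For every Φ ∈ C_c^∞(ℝ^n × ℝ^n) there exists a constant c ∈ (0,∞), depending only on n and Φ, such that for every L^∞ matrix A = (a_{μν})_{μ,ν∈ℤ^n} one has ‖σ_{A,Φ}‖_{M(L²×L² → (L²,ℓ¹))} ≤ c ‖A‖_B. -/
open MeasureTheory Complex
open scoped ENNReal NNReal

noncomputable section

abbrev Rn (n : ℕ) : Type := Fin n → ℝ
abbrev Zn (n : ℕ) : Type := Fin n → ℤ

/-- Coercion of a lattice point to a point of `ℝ^n`. -/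
def coeZ {n : ℕ} (μ : Zn n) : Rn n := fun i => (μ i : ℝ)

/-- The cube `aQ = [-a/2, a/2]^n`. -/
def cube (n : ℕ) (a : ℝ) : Set (Rn n) := Set.univ.pi fun _ => Set.Icc (-a / 2) (a / 2)

/-- A smooth compactly supported function. -/
def IsCcInfty {E : Type*} [NormedAddCommGroup E] [NormedSpace ℝ E] (Φ : E → ℂ) : Prop :=
  ContDiff ℝ (⊤ : ℕ∞) Φ ∧ HasCompactSupport Φ

/-- The Fourier transform of a Schwartz function. -/
def ft {n : ℕ} (f : SchwartzMap (Rn n) ℂ) (ξ : Rn n) : ℂ :=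
  ∫ x : Rn n, Complex.exp ((-2 * Real.pi * Complex.I) * ((∑ i, x i * ξ i : ℝ) : ℂ)) * f x

/-- The bilinear Fourier multiplier operator `T_σ(f,g)`. -/
def Tbil {n : ℕ} (σ : Rn n × Rn n → ℂ) (f g : SchwartzMap (Rn n) ℂ) (x : Rn n) : ℂ :=
  ∫ p : Rn n × Rn n,
    Complex.exp ((2 * Real.pi * Complex.I) * ((∑ i, x i * (p.1 i + p.2 i) : ℝ) : ℂ)) *
      σ p * ft f p.1 * ft g p.2

/-- `L²` norm of `h(·+ν)` on the unit cube `Q`. -/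
def localL2 {n : ℕ} (h : Rn n → ℂ) (ν : Zn n) : ℝ≥0∞ :=
  (∫⁻ x in cube n 1, (‖h (x + coeZ ν)‖₊ : ℝ≥0∞) ^ 2) ^ (1 / 2 : ℝ)

/-- The amalgam `(L², ℓ^q)` norm. -/
def amalgamNorm {n : ℕ} (q : ℝ≥0∞) (h : Rn n → ℂ) : ℝ≥0∞ :=
  if q = ∞ then ⨆ ν : Zn n, localL2 h ν
  else (∑' ν : Zn n, localL2 h ν ^ q.toReal) ^ (1 / q.toReal)

/-- The multiplier norm `‖σ‖_{M(L²×L² → (L²,ℓ^q))}`. -/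
def multNorm {n : ℕ} (q : ℝ≥0∞) (σ : Rn n × Rn n → ℂ) : ℝ≥0∞ :=
  ⨆ (f : SchwartzMap (Rn n) ℂ) (g : SchwartzMap (Rn n) ℂ)
    (_ : eLpNorm (⇑f) 2 volume = 1) (_ : eLpNorm (⇑g) 2 volume = 1),
    amalgamNorm q (Tbil σ f g)

/-- An `L^∞` matrix on `ℤ^n × ℤ^n`. -/
def IsLinftyMatrix {n : ℕ} (A : Zn n → Zn n → ℂ) : Prop :=
  ∃ C : ℝ, ∀ μ ν, ‖A μ ν‖ ≤ C

/-- The norm `‖A‖_B`: the trilinear form norm over finitely supported unit `ℓ²` vectors. -/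
def normB {n : ℕ} (A : Zn n → Zn n → ℂ) : ℝ≥0∞ :=
  ⨆ (F : Zn n →₀ ℂ) (G : Zn n →₀ ℂ) (H : Zn n →₀ ℂ)
    (_ : ∑ μ ∈ F.support, ‖F μ‖ ^ 2 = 1)
    (_ : ∑ ν ∈ G.support, ‖G ν‖ ^ 2 = 1)
    (_ : ∑ ρ ∈ H.support, ‖H ρ‖ ^ 2 = 1),
    (‖∑ μ ∈ F.support, ∑ ν ∈ G.support, A μ ν * F μ * G ν * H (μ + ν)‖₊ : ℝ≥0∞)

/-- The multiplier `σ_{A,Φ}(ξ,η) = Σ_{μ,ν} a_{μν} Φ(ξ-μ, η-ν)`. -/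
def sigmaA {n : ℕ} (A : Zn n → Zn n → ℂ) (Φ : Rn n × Rn n → ℂ) (p : Rn n × Rn n) : ℂ :=
  ∑' μν : Zn n × Zn n, A μν.1 μν.2 * Φ (p.1 - coeZ μν.1, p.2 - coeZ μν.2)

/-- Condition (A) for functions on `ℝ^d`. -/
def ConditionA {d : ℕ} (Φ : Rn d → ℂ) : Prop :=
  ∃ Θ : Rn d → ℂ, ContDiff ℝ (⊤ : ℕ∞) Θ ∧ HasCompactSupport Θ ∧
    ∀ α : Zn d, (∫ x : Rn d, Θ x * Φ (x - coeZ α)) = if α = 0 then 1 else 0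

/-- Condition (A) for functions on `ℝ^n × ℝ^n` (i.e. `d = 2n`). -/
def ConditionA2 {n : ℕ} (Φ : Rn n × Rn n → ℂ) : Prop :=
  ∃ Θ : Rn n × Rn n → ℂ, ContDiff ℝ (⊤ : ℕ∞) Θ ∧ HasCompactSupport Θ ∧
    ∀ α β : Zn n, (∫ p : Rn n × Rn n, Θ p * Φ (p.1 - coeZ α, p.2 - coeZ β)) =
      if α = 0 ∧ β = 0 then 1 else 0

/-- Condition (A) for functions on `ℝ` (the case `d = 1`). -/
def ConditionA1 (Φ : ℝ → ℂ) : Prop :=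
  ∃ θ : ℝ → ℂ, ContDiff ℝ (⊤ : ℕ∞) θ ∧ HasCompactSupport θ ∧
    ∀ j : ℤ, (∫ x : ℝ, θ x * Φ (x - (j : ℝ))) = if j = 0 then 1 else 0

/-- The `L^∞` (sup) norm, valued in `ℝ≥0∞`. -/
def supNorm {E : Type*} (u : E → ℂ) : ℝ≥0∞ := ⨆ x, (‖u x‖₊ : ℝ≥0∞)

end

open Set Filter Topology

/-- The character `t ↦ e^{2πit}` of the real line. -/
noncomputable def eChar (t : ℝ) : ℂ := Complex.exp ((2 * Real.pi * Complex.I) * (t : ℂ))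

lemma eChar_add (s t : ℝ) : eChar (s + t) = eChar s * eChar t := by
  simp [eChar, mul_add, Complex.exp_add]

@[simp] lemma norm_eChar (t : ℝ) : ‖eChar t‖ = 1 := by
  have : (2 * Real.pi * Complex.I) * (t : ℂ) = ((2 * Real.pi * t : ℝ) : ℂ) * Complex.I := by
    push_cast; ring
  rw [eChar, this, Complex.norm_exp_ofReal_mul_I]

@[simp] lemma enorm_eChar (t : ℝ) : ‖eChar t‖ₑ = 1 := by
  rw [← ofReal_norm, norm_eChar, ENNReal.ofReal_one]

lemma eChar_intCast (m : ℤ) : eChar m = 1 := by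
  rw [eChar, Complex.exp_eq_one_iff]
  exact ⟨m, by push_cast; ring⟩

@[fun_prop] lemma continuous_eChar : Continuous eChar := by
  unfold eChar; fun_prop

/-- The pairing of an integer vector with a real vector. -/
def intDot {ι : Type*} [Fintype ι] (k : ι → ℤ) (t : ι → ℝ) : ℝ := ∑ i, (k i : ℝ) * t i

@[fun_prop] lemma continuous_intDot {ι : Type*} [Fintype ι] (k : ι → ℤ) :
    Continuous (intDot k) := by
  unfold intDot; fun_prop

lemma intDot_neg {ι : Type*} [Fintype ι] (k : ι → ℤ) (t : ι → ℝ) :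
    intDot (-k) t = -intDot k t := by
  simp [intDot]

/-- The closed unit cube centred at the origin. -/
def unitBox (ι : Type*) : Set (ι → ℝ) := Set.univ.pi fun _ => Set.Icc (-1 / 2) (1 / 2)

section Torus

noncomputable local instance : MeasureSpace UnitAddCircle := ⟨AddCircle.haarAddCircle⟩

local instance : Measure.IsAddHaarMeasure (volume : Measure UnitAddCircle) :=
  inferInstanceAs (Measure.IsAddHaarMeasure AddCircle.haarAddCircle)

local instance : IsProbabilityMeasure (volume : Measure UnitAddCircle) :=
  inferInstanceAs (IsProbabilityMeasure AddCircle.haarAddCircle)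

variable {ι : Type*} [Fintype ι]

/-- The section of `ℝ^ι → (ℝ/ℤ)^ι` with values in `(-1/2, 1/2]^ι`. -/
noncomputable def torusSection (τ : UnitAddTorus ι) : ι → ℝ :=
  fun i => (AddCircle.equivIoc 1 (-1 / 2 : ℝ) (τ i)).1

lemma restrict_unitBox : (volume : Measure (ι → ℝ)).restrict (unitBox ι) =
    volume.restrict {x : ι → ℝ | ∀ i, x i ∈ Ioc (-1 / 2 : ℝ) (-1 / 2 + 1)} := by
  apply Measure.restrict_congr_set
  have h := Measure.univ_pi_Ioc_ae_eq_Icc (ι := ι) (α := fun _ => ℝ) (μ := fun _ => volume)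
    (f := fun _ => -1 / 2) (g := fun _ => 1 / 2)
  rw [← pi_univ_Icc] at h
  have hs : {x : ι → ℝ | ∀ i, x i ∈ Ioc (-1 / 2 : ℝ) (-1 / 2 + 1)} =
      univ.pi fun _ => Ioc (-1 / 2) (1 / 2) := by
    ext x
    simp only [mem_univ_pi, mem_ofPred_eq]
    norm_num
  rw [hs]
  exact h.symm

lemma measurePreserving_torusSection : MeasurePreserving (torusSection (ι := ι)) volume
    (volume.restrict (unitBox ι)) := by
  rw [restrict_unitBox]
  have h1 := UnitAddTorus.measurePreserving_equivPiIoc (d := ι) (fun _ => (-1 / 2 : ℝ))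
  have h2 := measurePreserving_subtype_coe (μa := (volume : Measure (ι → ℝ)))
    (s := {x : ι → ℝ | ∀ i, x i ∈ Ioc (-1 / 2 : ℝ) (-1 / 2 + 1)})
    (MeasurableSet.univ_pi' (fun i => measurableSet_Ioc))
  exact h2.comp h1

lemma mFourier_eq_eChar (k : ι → ℤ) (τ : UnitAddTorus ι) :
    UnitAddTorus.mFourier k τ = eChar (intDot k (torusSection τ)) := by
  have h : ∀ i, τ i = ((torusSection τ i : ℝ) : UnitAddCircle) := fun i =>
    (AddCircle.coe_equivIoc (p := (1 : ℝ)) (a := -1 / 2) (y := τ i)).symm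
  have h2 : UnitAddTorus.mFourier k τ = ∏ i, fourier (k i) (τ i) := rfl
  rw [h2, eChar, intDot, Complex.ofReal_sum, Finset.mul_sum, Complex.exp_sum]
  refine Finset.prod_congr rfl fun i _ => ?_
  conv_lhs => rw [h i]
  rw [fourier_coe_apply]
  congr 1
  push_cast; ring

lemma mFourierCoeff_comp_torusSection (k : ι → ℤ) {h : (ι → ℝ) → ℂ}
    (hh : AEStronglyMeasurable h (volume.restrict (unitBox ι))) :
    UnitAddTorus.mFourierCoeff (fun τ => h (torusSection τ)) k =
      ∫ t in unitBox ι, eChar (-intDot k t) * h t := by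
  rw [UnitAddTorus.mFourierCoeff, ← measurePreserving_torusSection.map_eq, integral_map
    measurePreserving_torusSection.aemeasurable]
  · simp only [mFourier_eq_eChar, intDot_neg, smul_eq_mul]
  · rw [measurePreserving_torusSection.map_eq]
    exact AEStronglyMeasurable.mul (by fun_prop) hh

/-- Parseval's identity on the unit cube. -/
lemma tsum_enorm_sq_fourierCoeff_unitBox {h : (ι → ℝ) → ℂ}
    (hh : MemLp h 2 (volume.restrict (unitBox ι))) :
    ∑' k : ι → ℤ, ‖∫ t in unitBox ι, eChar (-intDot k t) * h t‖ₑ ^ 2 =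
      ∫⁻ t in unitBox ι, ‖h t‖ₑ ^ 2 := by
  have hU := hh.comp_measurePreserving (measurePreserving_torusSection (ι := ι))
  have key := UnitAddTorus.hasSum_sq_mFourierCoeff (hU.toLp _)
  have hc : ∀ k, UnitAddTorus.mFourierCoeff (hU.toLp _) k =
      ∫ t in unitBox ι, eChar (-intDot k t) * h t := fun k => by
    rw [← mFourierCoeff_comp_torusSection k hh.1]
    refine integral_congr_ae ?_
    filter_upwards [hU.coeFn_toLp] with τ hτ
    rw [hτ]; rfl
  simp only [hc] at key
  have h1 : ∫ τ, ‖hU.toLp _ τ‖ ^ 2 = ∫ τ, ‖(h ∘ torusSection) τ‖ ^ 2 :=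
    integral_congr_ae (by filter_upwards [hU.coeFn_toLp] with τ hτ; rw [hτ])
  rw [h1] at key
  have h2 : ∫⁻ t in unitBox ι, ‖h t‖ₑ ^ 2 = ENNReal.ofReal (∫ τ, ‖(h ∘ torusSection) τ‖ ^ 2) := by
    rw [ofReal_integral_eq_lintegral_ofReal hU.integrable_norm_pow']
    · simp only [ENNReal.ofReal_pow (norm_nonneg _), ofReal_norm]
      rw [← measurePreserving_torusSection.map_eq, lintegral_map' _
        measurePreserving_torusSection.aemeasurable]
      · rfl
      · rw [measurePreserving_torusSection.map_eq]
        exact hh.1.enorm.pow_const 2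
    · exact .of_forall fun _ => by positivity
  rw [h2, ← key.tsum_eq, ENNReal.ofReal_tsum_of_nonneg (fun _ => by positivity) key.summable]
  simp only [ENNReal.ofReal_pow (norm_nonneg _), ofReal_norm]

/-- Bessel's inequality on the unit cube along an injective family of frequencies. -/
lemma tsum_enorm_sq_unitBox_le {κ : Type*} {φ : κ → ι → ℤ} (hφ : Function.Injective φ)
    {h : (ι → ℝ) → ℂ} (hh : MemLp h 2 (volume.restrict (unitBox ι))) :
    ∑' k, ‖∫ t in unitBox ι, eChar (intDot (φ k) t) * h t‖ₑ ^ 2 ≤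
      ∫⁻ t in unitBox ι, ‖h t‖ₑ ^ 2 := by
  rw [← tsum_enorm_sq_fourierCoeff_unitBox hh]
  have hi : Function.Injective fun k => -φ k := neg_injective.comp hφ
  refine le_trans (le_of_eq ?_) (ENNReal.tsum_comp_le_tsum_of_injective hi _)
  simp [intDot_neg]

/-- Parseval's identity for trigonometric polynomials. -/
lemma lintegral_enorm_sq_trigPoly (R : Finset (ι → ℤ)) (b : (ι → ℤ) → ℂ) :
    ∫⁻ t in unitBox ι, ‖∑ ρ ∈ R, b ρ * eChar (intDot ρ t)‖ₑ ^ 2 = ∑ ρ ∈ R, ‖b ρ‖ₑ ^ 2 := by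
  classical
  set W : Lp ℂ 2 (volume : Measure (UnitAddTorus ι)) :=
    ∑ ρ ∈ R, b ρ • UnitAddTorus.mFourierLp 2 ρ with hW
  have h1 : ‖W‖ ^ 2 = ∑ ρ ∈ R, ‖b ρ‖ ^ 2 := by
    have := UnitAddTorus.orthonormal_mFourier (d := ι).inner_sum b b R
    rw [← hW, inner_self_eq_norm_sq_to_K] at this
    have h3 : ∀ z : ℂ, (starRingEnd ℂ) z * z = ((‖z‖ ^ 2 : ℝ) : ℂ) := fun z => by
      rw [mul_comm, Complex.mul_conj, Complex.normSq_eq_norm_sq]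
    simp only [h3] at this
    apply Complex.ofReal_injective
    rw [Complex.ofReal_sum, ← this]
    simp
  have h2 : (W : UnitAddTorus ι → ℂ) =ᵐ[volume]
      fun τ => ∑ ρ ∈ R, b ρ * eChar (intDot ρ (torusSection τ)) := by
    have : W = ContinuousMap.toLp (E := ℂ) 2 volume ℂ (∑ ρ ∈ R, b ρ • UnitAddTorus.mFourier ρ) := by
      rw [hW, map_sum]; simp
    rw [this]
    filter_upwards [ContinuousMap.coeFn_toLp (𝕜 := ℂ) (p := 2) (volume : Measure (UnitAddTorus ι))
      (∑ ρ ∈ R, b ρ • UnitAddTorus.mFourier ρ)] with τ hτ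
    rw [hτ]
    simp [mFourier_eq_eChar]
  have h3 : ‖W‖ₑ ^ 2 = ∫⁻ t in unitBox ι, ‖∑ ρ ∈ R, b ρ * eChar (intDot ρ t)‖ₑ ^ 2 := by
    rw [Lp.enorm_def, eLpNorm_congr_ae h2, ← measurePreserving_torusSection.map_eq,
      lintegral_map (Continuous.measurable (by fun_prop)) measurePreserving_torusSection.measurable]
    have := eLpNorm_nnreal_pow_eq_lintegral (p := 2) (μ := (volume : Measure (UnitAddTorus ι)))
      (f := fun τ => ∑ ρ ∈ R, b ρ * eChar (intDot ρ (torusSection τ))) (by norm_num)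
    simpa using this
  rw [← h3, ← ofReal_norm, ← ENNReal.ofReal_pow (norm_nonneg _), h1,
    ENNReal.ofReal_sum_of_nonneg fun _ _ => by positivity]
  simp only [ENNReal.ofReal_pow (norm_nonneg _), ofReal_norm]

/-- A continuous function on the unit cube with absolutely summable Fourier coefficients is almost
everywhere the sum of its Fourier series. -/
lemma ae_hasSum_fourier_unitBox {u : (ι → ℝ) → ℂ} (hu : Continuous u)
    (hs : Summable fun k : ι → ℤ => ‖∫ t in unitBox ι, eChar (-intDot k t) * u t‖) :
    ∀ᵐ t ∂(volume.restrict (unitBox ι)),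
      HasSum (fun k : ι → ℤ => (∫ s in unitBox ι, eChar (-intDot k s) * u s) *
        eChar (intDot k t)) (u t) := by
  set c : (ι → ℤ) → ℂ := fun k => ∫ s in unitBox ι, eChar (-intDot k s) * u s with hc
  have hK : IsCompact (unitBox ι) := isCompact_univ_pi fun _ => isCompact_Icc
  have hu2 : MemLp u 2 (volume.restrict (unitBox ι)) := by
    have : IsFiniteMeasure (volume.restrict (unitBox ι)) :=
      isFiniteMeasure_restrict.2 hK.measure_lt_top.ne
    obtain ⟨C, hC⟩ := hK.exists_bound_of_continuousOn hu.continuousOn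
    exact MemLp.of_bound hu.aestronglyMeasurable C
      ((ae_restrict_iff' hK.measurableSet).2 (.of_forall hC))
  have hU := hu2.comp_measurePreserving (measurePreserving_torusSection (ι := ι))
  have hc' : ∀ k, UnitAddTorus.mFourierCoeff (hU.toLp _) k = c k := fun k => by
    simp only [hc]
    rw [← mFourierCoeff_comp_torusSection k hu2.1]
    refine integral_congr_ae ?_
    filter_upwards [hU.coeFn_toLp] with τ hτ
    rw [hτ]; rfl
  have hL2 := UnitAddTorus.hasSum_mFourier_series_L2 (hU.toLp _)
  simp only [hc'] at hL2
  have hsum : Summable fun k => c k • (UnitAddTorus.mFourier k : C(UnitAddTorus ι, ℂ)) :=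
    .of_norm (by simpa only [norm_smul, UnitAddTorus.mFourier_norm, mul_one] using hs)
  obtain ⟨V, hV⟩ := hsum
  have hV2 := (ContinuousMap.toLp (E := ℂ) 2 (volume : Measure (UnitAddTorus ι)) ℂ).hasSum hV
  simp only [map_smul] at hV2
  have hVU := hV2.unique hL2
  have hsumt : ∀ t, Summable fun k => c k * eChar (intDot k t) := fun t =>
    .of_norm (by simpa using hs)
  have hmeas : MeasurableSet {t : ι → ℝ | ∑' k, c k * eChar (intDot k t) = u t} := by
    refine measurableSet_eq_fun ?_ hu.measurable
    refine (continuous_tsum (u := fun k => ‖c k‖) (fun k => by fun_prop) hs fun k t => ?_).measurable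
    simp
  have hae : ∀ᵐ t ∂(volume.restrict (unitBox ι)), ∑' k, c k * eChar (intDot k t) = u t := by
    rw [← measurePreserving_torusSection.map_eq]
    refine (ae_map_iff measurePreserving_torusSection.aemeasurable hmeas).2 ?_
    filter_upwards [hU.coeFn_toLp, ContinuousMap.coeFn_toLp (𝕜 := ℂ) (p := 2)
      (volume : Measure (UnitAddTorus ι)) V] with τ h1 h2
    rw [hVU, h1] at h2
    have h3 := (ContinuousMap.evalCLM ℂ τ).hasSum hV
    simp only [ContinuousMap.evalCLM_apply, ContinuousMap.smul_apply, mFourier_eq_eChar,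
      smul_eq_mul] at h3
    have h4 : HasSum (fun k => c k * eChar (intDot k (torusSection τ))) (V τ) := h3
    rw [h4.tsum_eq, ← h2]; rfl
  filter_upwards [hae] with t ht
  rw [← ht]
  exact (hsumt t).hasSum

end Torus

lemma tendsto_product_self_atTop {ι : Type*} {S : ℕ → Finset ι} (hS : Tendsto S atTop atTop) :
    Tendsto (fun j => S j ×ˢ S j) atTop atTop := by
  have h : Tendsto (fun j => (S j, S j)) atTop (atTop ×ˢ atTop) := hS.prodMk hS
  rw [prod_atTop_atTop_eq] at h
  exact tendsto_finsetProd_atTop.comp h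

section TrilinearForm

variable {n : ℕ} {A : Zn n → Zn n → ℂ}

/-- The trilinear estimate defining `normB` for finitely supported functions that need not be
normalized. -/
lemma enorm_sq_trilinear_le_of_finsupp (F G H : Zn n →₀ ℂ) :
    ‖∑ μ ∈ F.support, ∑ ν ∈ G.support, A μ ν * F μ * G ν * H (μ + ν)‖ₑ ^ 2 ≤
      normB A ^ 2 * (∑ μ ∈ F.support, ‖F μ‖ₑ ^ 2) * (∑ ν ∈ G.support, ‖G ν‖ₑ ^ 2) *
        (∑ ρ ∈ H.support, ‖H ρ‖ₑ ^ 2) := by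
  rcases eq_or_ne F 0 with rfl | hF
  · simp
  rcases eq_or_ne G 0 with rfl | hG
  · simp
  rcases eq_or_ne H 0 with rfl | hH
  · simp
  have hpos : ∀ K : Zn n →₀ ℂ, K ≠ 0 → ∃ a : ℝ, 0 < a ∧
      a ^ 2 = ∑ μ ∈ K.support, ‖K μ‖ ^ 2 := fun K hK => by
    have h0 : 0 < ∑ μ ∈ K.support, ‖K μ‖ ^ 2 := by
      refine Finset.sum_pos (fun μ hμ => ?_) (Finsupp.support_nonempty_iff.2 hK)
      have := norm_pos_iff.2 (Finsupp.mem_support_iff.1 hμ)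
      positivity
    exact ⟨√(∑ μ ∈ K.support, ‖K μ‖ ^ 2), Real.sqrt_pos.2 h0, Real.sq_sqrt h0.le⟩
  have hsum : ∀ (K : Zn n →₀ ℂ) (a : ℝ), a ^ 2 = ∑ μ ∈ K.support, ‖K μ‖ ^ 2 →
      ∑ μ ∈ K.support, ‖K μ‖ₑ ^ 2 = ENNReal.ofReal (a ^ 2) := fun K a h => by
    rw [h, ENNReal.ofReal_sum_of_nonneg fun _ _ => by positivity]
    simp only [ENNReal.ofReal_pow (norm_nonneg _), ofReal_norm]
  obtain ⟨a, ha, ha2⟩ := hpos F hF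
  obtain ⟨b, hb, hb2⟩ := hpos G hG
  obtain ⟨c, hc, hc2⟩ := hpos H hH
  have hsupp : ∀ (K : Zn n →₀ ℂ) (a : ℝ), 0 < a → ((a : ℂ)⁻¹ • K).support = K.support :=
    fun K a h => Finsupp.support_smul_eq (inv_ne_zero (Complex.ofReal_ne_zero.2 h.ne'))
  have hnorm : ∀ (K : Zn n →₀ ℂ) (a : ℝ), 0 < a → a ^ 2 = ∑ μ ∈ K.support, ‖K μ‖ ^ 2 →
      ∑ μ ∈ ((a : ℂ)⁻¹ • K).support, ‖((a : ℂ)⁻¹ • K) μ‖ ^ 2 = 1 := fun K a h h2 => by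
    rw [hsupp K a h]
    simp only [Finsupp.smul_apply, smul_eq_mul, norm_mul, mul_pow, ← Finset.mul_sum, ← h2]
    simp [h.ne']
  have key : (‖∑ μ ∈ ((a : ℂ)⁻¹ • F).support, ∑ ν ∈ ((b : ℂ)⁻¹ • G).support, A μ ν *
      ((a : ℂ)⁻¹ • F) μ * ((b : ℂ)⁻¹ • G) ν * ((c : ℂ)⁻¹ • H) (μ + ν)‖ₑ) ≤ normB A := by
    unfold normB
    refine le_iSup_of_le ((a : ℂ)⁻¹ • F) <| le_iSup_of_le ((b : ℂ)⁻¹ • G) <|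
      le_iSup_of_le ((c : ℂ)⁻¹ • H) <| le_iSup_of_le (hnorm F a ha ha2) <|
      le_iSup_of_le (hnorm G b hb hb2) <| le_iSup_of_le (hnorm H c hc hc2) le_rfl
  rw [hsupp F a ha, hsupp G b hb] at key
  have heq : ∑ μ ∈ F.support, ∑ ν ∈ G.support, A μ ν * F μ * G ν * H (μ + ν) =
      ((a * b * c : ℝ) : ℂ) * ∑ μ ∈ F.support, ∑ ν ∈ G.support, A μ ν *
      ((a : ℂ)⁻¹ • F) μ * ((b : ℂ)⁻¹ • G) ν * ((c : ℂ)⁻¹ • H) (μ + ν) := by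
    simp only [Finset.mul_sum]
    refine Finset.sum_congr rfl fun μ _ => Finset.sum_congr rfl fun ν _ => ?_
    have h1 : (a : ℂ) ≠ 0 := Complex.ofReal_ne_zero.2 ha.ne'
    have h2 : (b : ℂ) ≠ 0 := Complex.ofReal_ne_zero.2 hb.ne'
    have h3 : (c : ℂ) ≠ 0 := Complex.ofReal_ne_zero.2 hc.ne'
    simp only [Finsupp.smul_apply, smul_eq_mul]
    push_cast
    field_simp
  have habc : ‖((a * b * c : ℝ) : ℂ)‖ₑ = ENNReal.ofReal a * ENNReal.ofReal b * ENNReal.ofReal c := by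
    rw [← ofReal_norm, Complex.norm_real, Real.norm_of_nonneg (by positivity),
      ENNReal.ofReal_mul (by positivity), ENNReal.ofReal_mul ha.le]
  rw [heq, enorm_mul, habc, hsum F a ha2, hsum G b hb2, hsum H c hc2,
    ENNReal.ofReal_pow ha.le, ENNReal.ofReal_pow hb.le, ENNReal.ofReal_pow hc.le]
  calc _ = ‖∑ μ ∈ F.support, ∑ ν ∈ G.support, A μ ν *
      ((a : ℂ)⁻¹ • F) μ * ((b : ℂ)⁻¹ • G) ν * ((c : ℂ)⁻¹ • H) (μ + ν)‖ₑ ^ 2 *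
        ENNReal.ofReal a ^ 2 * ENNReal.ofReal b ^ 2 * ENNReal.ofReal c ^ 2 := by ring
    _ ≤ _ := by gcongr

lemma enorm_sq_trilinear_le (S T R : Finset (Zn n)) (F G H : Zn n → ℂ)
    (hR : ∀ μ ∈ S, ∀ ν ∈ T, μ + ν ∈ R) :
    ‖∑ μ ∈ S, ∑ ν ∈ T, A μ ν * F μ * G ν * H (μ + ν)‖ₑ ^ 2 ≤
      normB A ^ 2 * (∑ μ ∈ S, ‖F μ‖ₑ ^ 2) * (∑ ν ∈ T, ‖G ν‖ₑ ^ 2) * (∑ ρ ∈ R, ‖H ρ‖ₑ ^ 2) := by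
  classical
  have hle : ∀ (S : Finset (Zn n)) (K : Zn n → ℂ),
      ∑ μ ∈ (Finsupp.indicator S fun μ _ => K μ).support,
        ‖(Finsupp.indicator S fun μ _ => K μ) μ‖ₑ ^ 2 ≤ ∑ μ ∈ S, ‖K μ‖ₑ ^ 2 := fun S K => by
    refine (Finset.sum_le_sum_of_subset (Finsupp.support_indicator_subset S _)).trans ?_
    refine Finset.sum_le_sum fun μ hμ => ?_
    simp [Finsupp.indicator_apply, hμ]
  have := enorm_sq_trilinear_le_of_finsupp (A := A) (Finsupp.indicator S fun μ _ => F μ)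
    (Finsupp.indicator T fun μ _ => G μ) (Finsupp.indicator R fun μ _ => H μ)
  refine le_trans (le_of_eq ?_) (this.trans (by gcongr <;> exact hle _ _))
  congr 2
  rw [Finset.sum_subset (Finsupp.support_indicator_subset S _)]
  · refine Finset.sum_congr rfl fun μ hμ => ?_
    rw [Finset.sum_subset (Finsupp.support_indicator_subset T _)]
    · refine Finset.sum_congr rfl fun ν hν => ?_
      simp [Finsupp.indicator_apply, hμ, hν, hR μ hμ ν hν]
    · intro ν _ hν
      rw [Finsupp.notMem_support_iff.1 hν]; simp
  · intro μ _ hμ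
    rw [Finsupp.notMem_support_iff.1 hμ]; simp

lemma lintegral_bilinear_trigPoly_le (S T : Finset (Zn n)) (F G : Zn n → ℂ) :
    ∫⁻ x in unitBox (Fin n), ‖∑ p ∈ S ×ˢ T, A p.1 p.2 * F p.1 * G p.2 *
        eChar (intDot (p.1 + p.2) x)‖ₑ ^ 2 ≤
      normB A ^ 2 * (∑ μ ∈ S, ‖F μ‖ₑ ^ 2) * (∑ ν ∈ T, ‖G ν‖ₑ ^ 2) := by
  classical
  set R := (S ×ˢ T).image fun p => p.1 + p.2 with hR
  set b : Zn n → ℂ := fun ρ => ∑ p ∈ S ×ˢ T with p.1 + p.2 = ρ, A p.1 p.2 * F p.1 * G p.2 with hb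
  have hfib : ∀ h : Zn n → ℂ, ∑ p ∈ S ×ˢ T, A p.1 p.2 * F p.1 * G p.2 * h (p.1 + p.2) =
      ∑ ρ ∈ R, b ρ * h ρ := fun h => by
    rw [← Finset.sum_fiberwise_of_maps_to (s := S ×ˢ T) (t := R)
      (g := fun p => p.1 + p.2) fun p hp => Finset.mem_image_of_mem _ hp]
    refine Finset.sum_congr rfl fun ρ _ => ?_
    rw [hb, Finset.sum_mul]
    refine Finset.sum_congr rfl fun p hp => ?_
    rw [(Finset.mem_filter.1 hp).2]
  simp only [fun x => hfib fun ρ => eChar (intDot ρ x)]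
  rw [lintegral_enorm_sq_trigPoly]
  have key := enorm_sq_trilinear_le (A := A) S T R F G (fun ρ => (starRingEnd ℂ) (b ρ))
    fun μ hμ ν hν => Finset.mem_image.2 ⟨(μ, ν), Finset.mk_mem_product hμ hν, rfl⟩
  rw [← Finset.sum_product' S T fun μ ν => A μ ν * F μ * G ν * (starRingEnd ℂ) (b (μ + ν)),
    hfib fun ρ => (starRingEnd ℂ) (b ρ)] at key
  have hX : ‖∑ ρ ∈ R, b ρ * (starRingEnd ℂ) (b ρ)‖ₑ = ∑ ρ ∈ R, ‖b ρ‖ₑ ^ 2 := by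
    have : ∑ ρ ∈ R, b ρ * (starRingEnd ℂ) (b ρ) = ((∑ ρ ∈ R, ‖b ρ‖ ^ 2 : ℝ) : ℂ) := by
      push_cast
      refine Finset.sum_congr rfl fun ρ _ => ?_
      rw [Complex.mul_conj, Complex.normSq_eq_norm_sq]; push_cast; rfl
    rw [this, ← ofReal_norm, Complex.norm_real, Real.norm_of_nonneg (by positivity),
      ENNReal.ofReal_sum_of_nonneg fun _ _ => by positivity]
    simp only [ENNReal.ofReal_pow (norm_nonneg _), ofReal_norm]
  simp only [hX, RCLike.enorm_conj] at key
  rcases eq_or_ne (∑ ρ ∈ R, ‖b ρ‖ₑ ^ 2) 0 with h0 | h0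
  · rw [h0]; exact zero_le
  · rw [sq] at key
    refine (ENNReal.mul_le_mul_iff_left h0 ?_).1 key
    exact ENNReal.sum_ne_top.2 fun ρ _ => by finiteness

lemma summable_bilinear {C : ℝ} (hA : ∀ μ ν, ‖A μ ν‖ ≤ C) {F G : Zn n → ℂ}
    (hF : Summable fun μ => ‖F μ‖) (hG : Summable fun μ => ‖G μ‖) :
    Summable fun p : Zn n × Zn n => ‖A p.1 p.2 * F p.1 * G p.2‖ := by
  refine Summable.of_nonneg_of_le (fun _ => norm_nonneg _) (fun p => ?_)
    ((hF.mul_of_nonneg hG (fun _ => norm_nonneg _) (fun _ => norm_nonneg _)).mul_left C)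
  rw [norm_mul, norm_mul, mul_assoc]
  gcongr
  exact hA _ _

/-- The bilinear square-function estimate for absolutely summable sequences. -/
lemma lintegral_bilinear_series_le {C : ℝ} (hA : ∀ μ ν, ‖A μ ν‖ ≤ C) {F G : Zn n → ℂ}
    (hF : Summable fun μ => ‖F μ‖) (hG : Summable fun μ => ‖G μ‖) :
    ∫⁻ x in unitBox (Fin n), ‖∑' p : Zn n × Zn n, A p.1 p.2 * F p.1 * G p.2 *
        eChar (intDot (p.1 + p.2) x)‖ₑ ^ 2 ≤
      normB A ^ 2 * (∑' μ, ‖F μ‖ₑ ^ 2) * (∑' ν, ‖G ν‖ₑ ^ 2) := by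
  have hs : ∀ x, Summable fun p : Zn n × Zn n => A p.1 p.2 * F p.1 * G p.2 *
      eChar (intDot (p.1 + p.2) x) := fun x =>
    .of_norm (by simpa only [norm_mul _ (eChar _), norm_eChar, mul_one] using
      summable_bilinear hA hF hG)
  obtain ⟨S, hS⟩ := exists_seq_tendsto (atTop : Filter (Finset (Zn n)))
  have hSS : Tendsto (fun j => S j ×ˢ S j) atTop atTop :=
    tendsto_product_self_atTop hS
  have hlim : ∀ x, Tendsto (fun j => ‖∑ p ∈ S j ×ˢ S j, A p.1 p.2 * F p.1 * G p.2 *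
      eChar (intDot (p.1 + p.2) x)‖ₑ ^ 2) atTop (𝓝 (‖∑' p : Zn n × Zn n, A p.1 p.2 * F p.1 *
        G p.2 * eChar (intDot (p.1 + p.2) x)‖ₑ ^ 2)) := fun x =>
    ((ENNReal.continuous_pow 2).tendsto _).comp
      ((continuous_enorm.tendsto _).comp ((hs x).hasSum.comp hSS))
  have hmeas : ∀ j, Measurable fun x => ‖∑ p ∈ S j ×ˢ S j, A p.1 p.2 * F p.1 *
      G p.2 * eChar (intDot (p.1 + p.2) x)‖ₑ ^ 2 := fun j => Continuous.measurable (by fun_prop)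
  calc _ = ∫⁻ x in unitBox (Fin n), liminf (fun j => ‖∑ p ∈ S j ×ˢ S j, A p.1 p.2 * F p.1 *
        G p.2 * eChar (intDot (p.1 + p.2) x)‖ₑ ^ 2) atTop :=
      lintegral_congr fun x => (hlim x).liminf_eq.symm
    _ ≤ liminf (fun j => ∫⁻ x in unitBox (Fin n), ‖∑ p ∈ S j ×ˢ S j, A p.1 p.2 * F p.1 *
        G p.2 * eChar (intDot (p.1 + p.2) x)‖ₑ ^ 2) atTop :=
      lintegral_liminf_le hmeas
    _ ≤ _ := by
      refine liminf_le_of_le (by isBoundedDefault) fun b hb => ?_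
      obtain ⟨j, hj⟩ := hb.exists
      refine hj.trans ((lintegral_bilinear_trigPoly_le _ _ F G).trans ?_)
      gcongr <;> exact ENNReal.sum_le_tsum _

end TrilinearForm

section SchwartzFourier

open scoped FourierTransform SchwartzMap

variable {ι : Type*} [Fintype ι]

/-- The Fourier transform on `ℝ^ι`, where `ℝ^ι` carries the supremum norm, preserves the Schwartz
space and the `L²` norm. -/
lemma exists_schwartzMap_fourier (f : 𝓢(ι → ℝ, ℂ)) :
    ∃ g : 𝓢(ι → ℝ, ℂ), (∀ w, g w = ∫ x : ι → ℝ, eChar (-∑ i, x i * w i) * f x) ∧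
      ∫⁻ w, ‖g w‖ₑ ^ 2 = ∫⁻ x, ‖f x‖ₑ ^ 2 := by
  let e := EuclideanSpace.equiv ι ℝ
  let f' : 𝓢(EuclideanSpace ℝ ι, ℂ) := SchwartzMap.compCLMOfContinuousLinearEquiv ℂ e f
  let g : 𝓢(ι → ℝ, ℂ) := SchwartzMap.compCLMOfContinuousLinearEquiv ℂ e.symm (𝓕 f')
  have hm := PiLp.volume_preserving_toLp ι
  have hme : MeasurableEmbedding (WithLp.toLp 2 : (ι → ℝ) → EuclideanSpace ℝ ι) :=
    (MeasurableEquiv.toLp 2 (ι → ℝ)).measurableEmbedding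
  have hl : ∀ h : 𝓢(EuclideanSpace ℝ ι, ℂ),
      ENNReal.ofReal (∫ x, ‖h x‖ ^ 2) = ∫⁻ x : ι → ℝ, ‖h (WithLp.toLp 2 x)‖ₑ ^ 2 := fun h => by
    rw [ofReal_integral_eq_lintegral_ofReal ((h.memLp 2 volume).integrable_norm_pow (by norm_num))
      (.of_forall fun _ => by positivity), ← hm.lintegral_comp_emb hme]
    simp only [ENNReal.ofReal_pow (norm_nonneg _), ofReal_norm]
  refine ⟨g, fun w => ?_, ?_⟩
  · have h1 : g w = (𝓕 (f' : EuclideanSpace ℝ ι → ℂ)) (WithLp.toLp 2 w) := by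
      rw [← SchwartzMap.fourier_coe]; rfl
    rw [h1, Real.fourier_eq', ← hm.integral_comp hme]
    refine integral_congr_ae (.of_forall fun x => ?_)
    have h2 : f' (WithLp.toLp 2 x) = f x := rfl
    have h3 : inner ℝ (WithLp.toLp 2 x : EuclideanSpace ℝ ι) (WithLp.toLp 2 w) =
        ∑ i, x i * w i := by
      simp [PiLp.inner_apply, mul_comm]
    simp only [h2, h3, smul_eq_mul, eChar]
    congr 2
    push_cast; ring
  · have h1 := hl (𝓕 f')
    rw [SchwartzMap.integral_norm_sq_fourier, hl] at h1
    exact h1.symm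

/-- The Fourier transform of a smooth compactly supported function decays rapidly. -/
lemma exists_fourier_decay {u : (ι → ℝ) → ℂ} (hu : IsCcInfty u) (m : ℕ) :
    ∃ C : ℝ, ∀ w : ι → ℝ, (1 + ‖w‖) ^ m * ‖∫ x : ι → ℝ, eChar (-∑ i, x i * w i) * u x‖ ≤ C := by
  obtain ⟨g, hg, -⟩ := exists_schwartzMap_fourier (hu.2.toSchwartzMap hu.1)
  refine ⟨2 ^ m * (Finset.Iic (m, 0)).sup (fun m => SchwartzMap.seminorm ℝ m.1 m.2) g,
    fun w => ?_⟩
  have := SchwartzMap.one_add_le_sup_seminorm_apply (𝕜 := ℝ) (m := (m, 0)) le_rfl le_rfl g w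
  rw [norm_iteratedFDeriv_zero, hg w] at this
  exact this

lemma exists_schwartzMap_ft {n : ℕ} (f : 𝓢(Rn n, ℂ)) (hf : eLpNorm (⇑f) 2 volume = 1) :
    ∃ g : 𝓢(Rn n, ℂ), ft f = g ∧ ∫⁻ w, ‖g w‖ₑ ^ 2 = 1 := by
  obtain ⟨g, hg, hg2⟩ := exists_schwartzMap_fourier f
  refine ⟨g, funext fun w => ?_, ?_⟩
  · rw [hg, ft]
    refine integral_congr_ae (.of_forall fun x => ?_)
    simp only [eChar]
    congr 2
    push_cast; ring
  · have := eLpNorm_nnreal_pow_eq_lintegral (p := 2) (μ := (volume : Measure (Rn n)))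
      (f := ⇑f) (by norm_num)
    simp only [ENNReal.coe_ofNat, hf] at this
    rw [hg2]
    simpa using this.symm

end SchwartzFourier

section KernelExpansion

lemma summable_prod_apply {ι κ : Type*} [Fintype ι] {f : κ → ℝ} (h0 : ∀ j, 0 ≤ f j)
    (hf : Summable f) : Summable fun k : ι → κ => ∏ i, f (k i) := by
  classical
  refine summable_of_sum_le (c := ∏ _i : ι, ∑' j, f j)
    (fun k => Finset.prod_nonneg fun i _ => h0 _) fun s => ?_
  calc ∑ k ∈ s, ∏ i, f (k i)
      ≤ ∑ k ∈ Fintype.piFinset fun i => s.image (· i), ∏ i, f (k i) :=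
        Finset.sum_le_sum_of_subset_of_nonneg
          (fun k hk => Fintype.mem_piFinset.2 fun i => Finset.mem_image_of_mem (· i) hk)
          fun k _ _ => Finset.prod_nonneg fun i _ => h0 _
    _ = ∏ i, ∑ j ∈ s.image (· i), f j := (Finset.prod_univ_sum _ _).symm
    _ ≤ _ := Finset.prod_le_prod (fun i _ => Finset.sum_nonneg fun j _ => h0 _)
          fun i _ => hf.sum_le_tsum _ fun j _ => h0 j

lemma summable_inv_one_add_abs_sq : Summable fun j : ℤ => ((1 + |(j : ℝ)|) ^ 2)⁻¹ := by
  have h : Summable fun m : ℕ => ((1 + (m : ℝ)) ^ 2)⁻¹ := by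
    have := (summable_nat_add_iff 1).2 (Real.summable_nat_pow_inv.2 (by norm_num : 1 < 2))
    simpa [add_comm] using this
  refine Summable.of_nat_of_neg ?_ ?_ <;> simpa using h

lemma summable_inv_one_add_norm_pow (n : ℕ) :
    Summable fun k : Zn n => ((1 + ‖k‖) ^ (2 * n))⁻¹ := by
  refine Summable.of_nonneg_of_le (fun k => by positivity) (fun k => ?_)
    (summable_prod_apply (ι := Fin n) (fun j => by positivity) summable_inv_one_add_abs_sq)
  rw [Finset.prod_inv_distrib]
  refine inv_anti₀ (Finset.prod_pos fun i _ => by positivity) ?_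
  calc ∏ i, (1 + |(k i : ℝ)|) ^ 2 ≤ ∏ _i : Fin n, (1 + ‖k‖) ^ 2 := by
        refine Finset.prod_le_prod (fun i _ => by positivity) fun i _ => ?_
        have := norm_le_pi_norm k i
        rw [Int.norm_eq_abs] at this
        gcongr
    _ = _ := by simp [pow_mul]

/-- The exponential `ξ ↦ e^{2πi k·ξ/N}` cut off to the cube `[-N/2, N/2]^n`. -/
noncomputable def window {n : ℕ} (N : ℕ) (k : Zn n) (ξ : Rn n) : ℂ :=
  {ξ : Rn n | (N : ℝ)⁻¹ • ξ ∈ unitBox (Fin n)}.indicator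
    (fun ξ => eChar (intDot k ((N : ℝ)⁻¹ • ξ))) ξ

lemma window_of_mem {n N : ℕ} {k : Zn n} {ξ : Rn n} (h : (N : ℝ)⁻¹ • ξ ∈ unitBox (Fin n)) :
    window N k ξ = eChar (intDot k ((N : ℝ)⁻¹ • ξ)) :=
  indicator_of_mem (show ξ ∈ {ξ : Rn n | (N : ℝ)⁻¹ • ξ ∈ unitBox (Fin n)} from h) _

lemma window_of_notMem {n N : ℕ} {k : Zn n} {ξ : Rn n} (h : (N : ℝ)⁻¹ • ξ ∉ unitBox (Fin n)) :
    window N k ξ = 0 :=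
  indicator_of_notMem (show ξ ∉ {ξ : Rn n | (N : ℝ)⁻¹ • ξ ∈ unitBox (Fin n)} from h) _

lemma exists_box_of_hasCompactSupport {n : ℕ} {Φ : Rn n × Rn n → ℂ} (hΦ : HasCompactSupport Φ) :
    ∃ N : ℕ, 0 < N ∧ ∀ p, Φ p ≠ 0 →
      (N : ℝ)⁻¹ • p.1 ∈ unitBox (Fin n) ∧ (N : ℝ)⁻¹ • p.2 ∈ unitBox (Fin n) := by
  obtain ⟨R, hR⟩ := hΦ.isCompact.isBounded.exists_norm_le
  obtain ⟨M, hM⟩ := exists_nat_ge R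
  have hbox : ∀ ξ : Rn n, ‖ξ‖ ≤ R → ((2 * M + 1 : ℕ) : ℝ)⁻¹ • ξ ∈ unitBox (Fin n) := by
    intro ξ hξ i _
    have h1 : |ξ i| ≤ M := (norm_le_pi_norm ξ i).trans (hξ.trans hM)
    have h2 : (0 : ℝ) < ((2 * M + 1 : ℕ) : ℝ) := by positivity
    rw [abs_le] at h1
    simp only [Pi.smul_apply, smul_eq_mul, mem_Icc, inv_mul_eq_div]
    rw [le_div_iff₀ h2, div_le_iff₀ h2]
    push_cast
    constructor <;> linarith
  refine ⟨2 * M + 1, by positivity, fun p hp => ?_⟩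
  have hp' := hR p (subset_tsupport _ hp)
  exact ⟨hbox _ ((norm_fst_le p).trans hp'), hbox _ ((norm_snd_le p).trans hp')⟩

lemma exists_fourierCoeff_bound {n : ℕ} {ψ : (Fin n ⊕ Fin n → ℝ) → ℂ} (hψ : IsCcInfty ψ) (N : ℕ) :
    ∃ D : Zn n → ℝ, (∀ k, 0 ≤ D k) ∧ Summable D ∧ ∀ x ∈ unitBox (Fin n), ∀ k l : Zn n,
      ‖∫ t, eChar (-intDot (Sum.elim k l) t) *
        (eChar (N * ∑ i, x i * (t (.inl i) + t (.inr i))) * ψ t)‖ ≤ D k * D l := by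
  obtain ⟨C, hC⟩ := exists_fourier_decay hψ (4 * n)
  set B : ℝ := (1 + |C|) * (1 + N) ^ (4 * n) with hB
  have hB1 : 1 ≤ B := one_le_mul_of_one_le_of_one_le (by linarith [abs_nonneg C])
    (one_le_pow₀ (by linarith [N.cast_nonneg (α := ℝ)]))
  refine ⟨fun k => B * ((1 + ‖k‖) ^ (2 * n))⁻¹, fun k => by positivity,
    (summable_inv_one_add_norm_pow n).mul_left B, fun x hx k l => ?_⟩
  set K : Fin n ⊕ Fin n → ℤ := Sum.elim k l with hK
  set w : Fin n ⊕ Fin n → ℝ := fun i => (K i : ℝ) - N * Sum.elim x x i with hw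
  have hint : (∫ t, eChar (-intDot K t) *
      (eChar (N * ∑ i, x i * (t (.inl i) + t (.inr i))) * ψ t)) =
      ∫ t, eChar (-∑ i, t i * w i) * ψ t := by
    refine integral_congr_ae (.of_forall fun t => ?_)
    simp only [← mul_assoc, ← eChar_add]
    congr 2
    simp only [intDot, hw, Fintype.sum_sum_type, Sum.elim_inl, Sum.elim_inr, Finset.mul_sum,
      ← Finset.sum_neg_distrib, ← Finset.sum_add_distrib]
    exact Finset.sum_congr rfl fun i _ => by ring
  have hkl : ∀ r : ℝ, 0 ≤ r → (∀ i, |(K i : ℝ)| ≤ r) → ‖k‖ ≤ r ∧ ‖l‖ ≤ r := fun r hr h =>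
    ⟨(pi_norm_le_iff_of_nonneg hr).2 fun i => (Int.norm_eq_abs (k i)).trans_le (h (.inl i)),
      (pi_norm_le_iff_of_nonneg hr).2 fun i => (Int.norm_eq_abs (l i)).trans_le (h (.inr i))⟩
  have hKw : ∀ i, |(K i : ℝ)| ≤ ‖w‖ + N := fun i => by
    have h1 : |w i| ≤ ‖w‖ := norm_le_pi_norm w i
    have h2 : |(Sum.elim x x i : ℝ)| ≤ 1 := by
      have : ∀ j, |x j| ≤ 1 := fun j => by
        have := hx j (mem_univ j)
        rw [mem_Icc] at this
        rw [abs_le]; constructor <;> linarith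
      rcases i with i | i <;> simpa using this i
    have h3 : (K i : ℝ) = w i + N * Sum.elim x x i := by simp [hw]
    rw [h3]
    refine (abs_add_le _ _).trans (add_le_add h1 ?_)
    rw [abs_mul, Nat.abs_cast]
    exact mul_le_of_le_one_right (Nat.cast_nonneg _) h2
  obtain ⟨hk, hl⟩ := hkl _ (by positivity) hKw
  have hN0 : (0 : ℝ) ≤ N := N.cast_nonneg
  have hgrow : ∀ r : ℝ, r ≤ ‖w‖ + N → 1 + r ≤ (1 + N) * (1 + ‖w‖) := fun r hr => by
    nlinarith [norm_nonneg w]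
  rw [hint]
  set I := ‖∫ t, eChar (-∑ i, t i * w i) * ψ t‖ with hI
  have key : ((1 + ‖k‖) ^ (2 * n) * (1 + ‖l‖) ^ (2 * n)) * I ≤ B * B := by
    calc ((1 + ‖k‖) ^ (2 * n) * (1 + ‖l‖) ^ (2 * n)) * I
        ≤ (((1 + N) * (1 + ‖w‖)) ^ (2 * n) * ((1 + N) * (1 + ‖w‖)) ^ (2 * n)) * I := by
          gcongr
          · exact hgrow _ hk
          · exact hgrow _ hl
      _ = (1 + N) ^ (4 * n) * ((1 + ‖w‖) ^ (4 * n) * I) := by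
          rw [← pow_add, mul_pow, show 2 * n + 2 * n = 4 * n by ring]; ring
      _ ≤ (1 + N) ^ (4 * n) * (1 + |C|) := by
          gcongr
          exact (hC w).trans ((le_abs_self C).trans (by linarith))
      _ = B := by rw [hB, mul_comm]
      _ ≤ B * B := le_mul_of_one_le_left (by linarith) hB1
  calc I ≤ B * B / ((1 + ‖k‖) ^ (2 * n) * (1 + ‖l‖) ^ (2 * n)) := by
        rw [le_div_iff₀ (by positivity), mul_comm]; exact key
    _ = _ := by rw [div_eq_mul_inv, mul_inv]; ring

/-- Fourier expansion, on a large cube, of `Φ` times a character, with coefficients dominated by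
a summable product uniformly in the character. -/
lemma exists_window_expansion {n : ℕ} {Φ : Rn n × Rn n → ℂ} (hΦ : IsCcInfty Φ) :
    ∃ N : ℕ, 0 < N ∧ ∃ D : Zn n → ℝ, (∀ k, 0 ≤ D k) ∧ Summable D ∧
      ∀ x ∈ unitBox (Fin n), ∃ c : Zn n → Zn n → ℂ, (∀ k l, ‖c k l‖ ≤ D k * D l) ∧
        ∀ᵐ p : Rn n × Rn n, HasSum (fun kl : Zn n × Zn n =>
          c kl.1 kl.2 * (window N kl.1 p.1 * window N kl.2 p.2))
          (eChar (∑ i, x i * (p.1 i + p.2 i)) * Φ p) := by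
  obtain ⟨N, hN, hbox⟩ := exists_box_of_hasCompactSupport hΦ.2
  have hN0 : (N : ℝ) ≠ 0 := by positivity
  let e : (Fin n ⊕ Fin n → ℝ) ≃L[ℝ] Rn n × Rn n :=
    ContinuousLinearEquiv.sumPiEquivProdPi ℝ (Fin n) (Fin n) fun _ => ℝ
  let ψ : (Fin n ⊕ Fin n → ℝ) → ℂ := fun t => Φ ((N : ℝ) • e t)
  have hψ : IsCcInfty ψ :=
    ⟨hΦ.1.comp (e.contDiff.const_smul (N : ℝ)),
      (hΦ.2.comp_smul hN0).comp_homeomorph e.toHomeomorph⟩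
  have hmem : ∀ t : Fin n ⊕ Fin n → ℝ, t ∈ unitBox (Fin n ⊕ Fin n) ↔
      (e t).1 ∈ unitBox (Fin n) ∧ (e t).2 ∈ unitBox (Fin n) := fun t =>
    ⟨fun h => ⟨fun i _ => h (.inl i) trivial, fun i _ => h (.inr i) trivial⟩, fun h i _ => by
      rcases i with i | i
      exacts [h.1 i trivial, h.2 i trivial]⟩
  have hψ0 : ∀ t, t ∉ unitBox (Fin n ⊕ Fin n) → ψ t = 0 := fun t ht => by
    by_contra h
    refine ht ((hmem t).2 ?_)
    simpa [smul_smul, inv_mul_cancel₀ hN0] using hbox _ h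
  obtain ⟨D, hD0, hDs, hD⟩ := exists_fourierCoeff_bound hψ N
  refine ⟨N, hN, D, hD0, hDs, fun x hx => ?_⟩
  let u : (Fin n ⊕ Fin n → ℝ) → ℂ := fun t =>
    eChar (N * ∑ i, x i * (t (.inl i) + t (.inr i))) * ψ t
  have hu : Continuous u := by
    have := hψ.1.continuous
    fun_prop
  have hset : ∀ K : Fin n ⊕ Fin n → ℤ, (∫ t in unitBox (Fin n ⊕ Fin n), eChar (-intDot K t) * u t)
      = ∫ t, eChar (-intDot K t) * u t := fun K =>
    setIntegral_eq_integral_of_forall_compl_eq_zero fun t ht => by simp [u, hψ0 t ht]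
  let E := Equiv.sumArrowEquivProdArrow (Fin n) (Fin n) ℤ
  have hE : ∀ kl, E.symm kl = Sum.elim kl.1 kl.2 := fun kl => rfl
  have hsum : Summable fun K : Fin n ⊕ Fin n → ℤ =>
      ‖∫ t in unitBox (Fin n ⊕ Fin n), eChar (-intDot K t) * u t‖ := by
    rw [← E.symm.summable_iff]
    refine Summable.of_nonneg_of_le (fun _ => norm_nonneg _) (fun kl => ?_)
      (hDs.mul_of_nonneg hDs hD0 hD0)
    simp only [Function.comp_apply, hset, hE]
    exact hD x hx kl.1 kl.2
  have hae := (ae_restrict_iff' (MeasurableSet.univ_pi fun _ => measurableSet_Icc)).1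
    (ae_hasSum_fourier_unitBox hu hsum)
  have : (volume : Measure (Rn n × Rn n)).IsAddHaarMeasure :=
    Measure.prod.instIsAddHaarMeasure volume volume
  have hq : Measure.QuasiMeasurePreserving (fun p : Rn n × Rn n => e.symm ((N : ℝ)⁻¹ • p))
      volume volume :=
    (volume_measurePreserving_sumPiEquivProdPi_symm
      (fun _ : Fin n ⊕ Fin n => ℝ)).quasiMeasurePreserving.comp
      (Measure.quasiMeasurePreserving_smul volume (inv_ne_zero hN0))
  refine ⟨fun k l => ∫ t, eChar (-intDot (Sum.elim k l) t) * u t, hD x hx, ?_⟩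
  filter_upwards [hq.ae hae] with p hp
  set t := e.symm ((N : ℝ)⁻¹ • p) with ht
  have het : e t = (N : ℝ)⁻¹ • p := by simp [ht]
  by_cases h : t ∈ unitBox (Fin n ⊕ Fin n)
  · have h' := hp h
    rw [← E.symm.hasSum_iff] at h'
    obtain ⟨h1, h2⟩ := (hmem t).1 h
    rw [het] at h1 h2
    have hpt : p = (N : ℝ) • e t := by rw [het, smul_smul, mul_inv_cancel₀ hN0, one_smul]
    have hu' : u t = eChar (∑ i, x i * (p.1 i + p.2 i)) * Φ p := by
      have h3 : ∀ i, p.1 i = N * t (.inl i) := fun i => by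
        conv_lhs => rw [hpt]
        rfl
      have h4 : ∀ i, p.2 i = N * t (.inr i) := fun i => by
        conv_lhs => rw [hpt]
        rfl
      have h5 : Φ p = ψ t := by rw [hpt]
      rw [h5]
      simp only [u, h3, h4, Finset.mul_sum]
      congr 2
      exact Finset.sum_congr rfl fun i _ => by ring
    rw [← hu']
    convert h' using 1
    funext kl
    simp only [Function.comp_apply, hset, hE, window_of_mem h1, window_of_mem h2, ← eChar_add]
    congr 2
    simp only [intDot, Fintype.sum_sum_type, Sum.elim_inl, Sum.elim_inr]
    rfl
  · rw [hmem, het, not_and_or] at h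
    have hΦ0 : Φ p = 0 := by
      by_contra h'
      obtain ⟨h1, h2⟩ := hbox p h'
      exact h.elim (· h1) (· h2)
    have hw : ∀ kl : Zn n × Zn n, window N kl.1 p.1 * window N kl.2 p.2 = 0 := fun kl => by
      rcases h with h | h
      · rw [window_of_notMem h, zero_mul]
      · rw [window_of_notMem (k := kl.2) h, mul_zero]
    simpa only [hΦ0, hw, mul_zero] using hasSum_zero

end KernelExpansion

section FrequencyCoefficients

variable {n N : ℕ}

lemma enorm_window (k : Zn n) (ξ : Rn n) :
    ‖window N k ξ‖ₑ = {ξ : Rn n | (N : ℝ)⁻¹ • ξ ∈ unitBox (Fin n)}.indicator 1 ξ := by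
  by_cases h : (N : ℝ)⁻¹ • ξ ∈ unitBox (Fin n)
  · rw [window_of_mem h, enorm_eChar, indicator_of_mem (by exact h), Pi.one_apply]
  · rw [window_of_notMem h, enorm_zero, indicator_of_notMem (by exact h)]

lemma norm_window_eq (k : Zn n) (ξ : Rn n) : ‖window N k ξ‖ = ‖window N 0 ξ‖ := by
  rw [← toReal_enorm, ← toReal_enorm, enorm_window, enorm_window]

lemma norm_window_le_one (k : Zn n) (ξ : Rn n) : ‖window N k ξ‖ ≤ 1 := by
  by_cases h : (N : ℝ)⁻¹ • ξ ∈ unitBox (Fin n)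
  · rw [window_of_mem h, norm_eChar]
  · rw [window_of_notMem h, norm_zero]; exact zero_le_one

lemma measurableSet_unitBox {ι : Type*} [Fintype ι] : MeasurableSet (unitBox ι) :=
  MeasurableSet.univ_pi fun _ => measurableSet_Icc

lemma measurable_window (k : Zn n) : Measurable (window N k) := by
  refine Measurable.indicator (Continuous.measurable (by fun_prop))
    (measurableSet_unitBox.preimage (measurable_const_smul (N : ℝ)⁻¹))

lemma tsum_enorm_window_le (hN : 0 < N) (k : Zn n) (ξ : Rn n) :
    ∑' μ : Zn n, ‖window N k (ξ - coeZ μ)‖ₑ ≤ ((N + 1) ^ n : ℕ) := by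
  have hN0 : (0 : ℝ) < N := by positivity
  let T : Finset (Zn n) := Fintype.piFinset fun i => Finset.Icc ⌈ξ i - N / 2⌉ ⌊ξ i + N / 2⌋
  have hT : T.card ≤ (N + 1) ^ n := by
    rw [Fintype.card_piFinset]
    refine (Finset.prod_le_pow_card _ _ (N + 1) fun i _ => ?_).trans (by simp)
    rw [Int.card_Icc]
    have h1 := Int.le_ceil (ξ i - N / 2)
    have h2 := Int.floor_le (ξ i + N / 2)
    have h3 : ((⌊ξ i + N / 2⌋ - ⌈ξ i - N / 2⌉ : ℤ) : ℝ) ≤ (N : ℤ) := by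
      push_cast; linarith
    have := Int.cast_le.1 h3
    omega
  rw [tsum_eq_sum (s := T)]
  · refine (Finset.sum_le_card_nsmul T _ 1 fun μ _ => ?_).trans ?_
    · simpa [← ofReal_norm] using norm_window_le_one k (ξ - coeZ μ)
    · rw [nsmul_eq_mul, mul_one]
      exact_mod_cast hT
  · intro μ hμ
    rw [window_of_notMem, enorm_zero]
    contrapose! hμ
    refine Fintype.mem_piFinset.2 fun i => ?_
    have h := hμ i trivial
    simp only [Pi.smul_apply, Pi.sub_apply, coeZ, smul_eq_mul, mem_Icc, inv_mul_eq_div] at h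
    rw [le_div_iff₀ hN0, div_le_iff₀ hN0] at h
    rw [Finset.mem_Icc, Int.ceil_le, Int.le_floor]
    constructor <;> linarith

lemma summable_norm_window (hN : 0 < N) (k : Zn n) (ξ : Rn n) :
    Summable fun μ : Zn n => ‖window N k (ξ - coeZ μ)‖ := by
  have := ((tsum_enorm_window_le hN k ξ).trans_lt (ENNReal.natCast_lt_top _)).ne
  simpa using ENNReal.summable_toReal this

lemma tsum_lintegral_window_le (hN : 0 < N) (k : Zn n) {u : Rn n → ℝ≥0∞} (hu : AEMeasurable u) :
    ∑' μ : Zn n, ∫⁻ ξ, ‖window N k (ξ - coeZ μ)‖ₑ * u ξ ≤ ((N + 1) ^ n : ℕ) * ∫⁻ ξ, u ξ := by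
  have hw : ∀ μ : Zn n, Measurable fun ξ => ‖window N k (ξ - coeZ μ)‖ₑ := fun μ =>
    ((measurable_window k).comp (measurable_id.sub_const _)).enorm
  rw [← lintegral_tsum (f := fun μ ξ => ‖window N k (ξ - coeZ μ)‖ₑ * u ξ)
    fun μ => (hw μ).aemeasurable.mul hu,
    ← lintegral_const_mul' _ _ (ENNReal.natCast_ne_top _)]
  refine lintegral_mono fun ξ => ?_
  rw [ENNReal.tsum_mul_right]
  gcongr
  exact tsum_enorm_window_le hN k ξ

/-- The frequency localized function whose integral is a local Fourier coefficient of `φ`. -/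
noncomputable def windowed (N : ℕ) (φ : Rn n → ℂ) (k ρ μ : Zn n) (ξ : Rn n) : ℂ :=
  window N k (ξ - coeZ μ) * (eChar (intDot ρ ξ) * φ ξ)

lemma norm_windowed (φ : Rn n → ℂ) (k ρ μ : Zn n) (ξ : Rn n) :
    ‖windowed N φ k ρ μ ξ‖ = ‖window N 0 (ξ - coeZ μ)‖ * ‖φ ξ‖ := by
  rw [windowed, norm_mul, norm_mul, norm_eChar, one_mul, norm_window_eq]

lemma integrable_windowed {φ : Rn n → ℂ} (hφ : Integrable φ) (k ρ μ : Zn n) :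
    Integrable (windowed N φ k ρ μ) := by
  have hw : Measurable fun ξ => window N k (ξ - coeZ μ) :=
    (measurable_window k).comp (measurable_id.sub_const _)
  have he : Measurable fun ξ : Rn n => eChar (intDot ρ ξ) := Continuous.measurable (by fun_prop)
  refine hφ.mono (hw.aestronglyMeasurable.mul (he.aestronglyMeasurable.mul hφ.1))
    (.of_forall fun ξ => ?_)
  rw [norm_windowed]
  exact mul_le_of_le_one_left (norm_nonneg _) (norm_window_le_one _ _)

lemma summable_integral_norm_windowed (hN : 0 < N) {φ : Rn n → ℂ} (hφ : Integrable φ) :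
    Summable fun μ : Zn n => ∫ ξ, ‖window N 0 (ξ - coeZ μ)‖ * ‖φ ξ‖ := by
  have h := tsum_lintegral_window_le hN 0 hφ.1.enorm
  have h' := (h.trans_lt (ENNReal.mul_lt_top (ENNReal.natCast_lt_top _) hφ.2)).ne
  refine (ENNReal.summable_toReal h').congr fun μ => ?_
  have := integrable_windowed (N := N) hφ 0 0 μ
  rw [← integral_congr_ae (.of_forall (norm_windowed (N := N) φ 0 0 μ)),
    integral_norm_eq_lintegral_enorm this.1]
  congr 1
  refine lintegral_congr fun ξ => ?_
  simp [windowed]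

/-- The local Fourier coefficients of `φ`. -/
noncomputable def freqCoeff (N : ℕ) (φ : Rn n → ℂ) (k ρ μ : Zn n) : ℂ :=
  ∫ ξ, windowed N φ k ρ μ ξ

lemma summable_norm_freqCoeff (hN : 0 < N) {φ : Rn n → ℂ} (hφ : Integrable φ) (k ρ : Zn n) :
    Summable fun μ => ‖freqCoeff N φ k ρ μ‖ := by
  refine Summable.of_nonneg_of_le (fun _ => norm_nonneg _) (fun μ => ?_)
    (summable_integral_norm_windowed hN hφ)
  refine (norm_integral_le_integral_norm _).trans_eq ?_
  simp only [norm_windowed]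

lemma lintegral_comp_natCast_smul (hN : 0 < N) {u : Rn n → ℝ≥0∞} (hu : AEMeasurable u) :
    (N : ℝ≥0∞) ^ n * ∫⁻ t, u ((N : ℝ) • t) = ∫⁻ ξ, u ξ := by
  have hN0 : (N : ℝ) ≠ 0 := by positivity
  have hN1 : (N : ℝ≥0∞) ≠ 0 := by exact_mod_cast hN.ne'
  have hmap := Measure.map_addHaar_smul (volume : Measure (Rn n)) hN0
  have hu' : AEMeasurable u (Measure.map (fun t : Rn n => (N : ℝ) • t) volume) :=
    hu.mono_ac (Measure.quasiMeasurePreserving_smul volume hN0).absolutelyContinuous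
  rw [← lintegral_map' hu' (measurable_const_smul (N : ℝ)).aemeasurable, hmap,
    lintegral_smul_measure, smul_eq_mul, ← mul_assoc, Module.finrank_fin_fun,
    abs_of_nonneg (by positivity), ENNReal.ofReal_inv_of_pos (by positivity),
    ENNReal.ofReal_pow (by positivity), ENNReal.ofReal_natCast,
    ENNReal.mul_inv_cancel (pow_ne_zero _ hN1) (by finiteness), one_mul]

lemma freqCoeff_eq (hN : 0 < N) (φ : Rn n → ℂ) (k ρ μ : Zn n) :
    freqCoeff N φ k ρ μ = (N : ℂ) ^ n * ∫ t in unitBox (Fin n),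
      eChar (intDot (k + N • ρ) t) * φ ((N : ℝ) • t + coeZ μ) := by
  have hN0 : (N : ℝ) ≠ 0 := by positivity
  have h1 : freqCoeff N φ k ρ μ = ∫ ξ, window N k ξ * (eChar (intDot ρ ξ) * φ (ξ + coeZ μ)) := by
    rw [freqCoeff, ← integral_add_right_eq_self _ (coeZ μ)]
    refine integral_congr_ae (.of_forall fun ξ => ?_)
    have h2 : intDot ρ (ξ + coeZ μ) = intDot ρ ξ + (∑ i, ρ i * μ i : ℤ) := by
      simp [intDot, coeZ, mul_add, Finset.sum_add_distrib]
    simp only [windowed, add_sub_cancel_right, h2, eChar_add, eChar_intCast, mul_one]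
  have h2 := Measure.integral_comp_smul (volume : Measure (Rn n))
    (fun ξ => window N k ξ * (eChar (intDot ρ ξ) * φ (ξ + coeZ μ))) (N : ℝ)
  rw [h1, ← integral_indicator measurableSet_unitBox]
  rw [← smul_right_injective _ (show |((N : ℝ) ^ Module.finrank ℝ (Rn n))⁻¹| ≠ 0 by positivity)
    |>.eq_iff]
  rw [← h2, Module.finrank_fin_fun, abs_of_nonneg (by positivity), Complex.real_smul, ← mul_assoc]
  push_cast
  rw [inv_mul_cancel₀ (by exact_mod_cast pow_ne_zero _ hN0), one_mul]
  refine integral_congr_ae (.of_forall fun t => ?_)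
  have ht : (N : ℝ)⁻¹ • (N : ℝ) • t = t := by rw [smul_smul, inv_mul_cancel₀ hN0, one_smul]
  by_cases h : t ∈ unitBox (Fin n)
  · simp only [indicator_of_mem h]
    rw [window_of_mem (by rwa [ht]), ht, ← mul_assoc, ← eChar_add]
    congr 2
    simp only [intDot, ← Finset.sum_add_distrib]
    refine Finset.sum_congr rfl fun i _ => ?_
    simp; ring
  · simp only [indicator_of_notMem h]
    rw [window_of_notMem (by rwa [ht]), zero_mul]

lemma tsum_enorm_sq_freqCoeff_le (hN : 0 < N) {φ : Rn n → ℂ} (hφ : MemLp φ 2) (k μ : Zn n) :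
    ∑' ρ, ‖freqCoeff N φ k ρ μ‖ₑ ^ 2 ≤
      (N : ℝ≥0∞) ^ n * ∫⁻ ξ, ‖window N 0 (ξ - coeZ μ)‖ₑ * ‖φ ξ‖ₑ ^ 2 := by
  have hN0 : (N : ℝ) ≠ 0 := by positivity
  set h : Rn n → ℂ := fun t => φ ((N : ℝ) • t + coeZ μ) with hh
  have hmem : MemLp h 2 (volume.restrict (unitBox (Fin n))) := by
    refine MemLp.restrict _ ?_
    have h1 : MemLp (fun ξ => φ (ξ + coeZ μ)) 2 :=
      hφ.comp_measurePreserving (measurePreserving_add_right volume (coeZ μ))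
    refine MemLp.comp_of_map (f := fun t : Rn n => (N : ℝ) • t) ?_
      (measurable_const_smul (N : ℝ)).aemeasurable (g := fun ξ => φ (ξ + coeZ μ))
    rw [Measure.map_addHaar_smul volume hN0]
    exact h1.smul_measure ENNReal.ofReal_ne_top
  have hbox : (N : ℝ≥0∞) ^ n * ∫⁻ t in unitBox (Fin n), ‖h t‖ₑ ^ 2 =
      ∫⁻ ξ, ‖window N 0 (ξ - coeZ μ)‖ₑ * ‖φ ξ‖ₑ ^ 2 := by
    have hu : AEMeasurable fun ξ => ‖window N 0 ξ‖ₑ * ‖φ (ξ + coeZ μ)‖ₑ ^ 2 :=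
      (measurable_window 0).enorm.aemeasurable.mul
        (((hφ.1.comp_measurePreserving
          (measurePreserving_add_right volume (coeZ μ))).enorm).pow_const 2)
    rw [← lintegral_add_right_eq_self (fun ξ => ‖window N 0 (ξ - coeZ μ)‖ₑ * ‖φ ξ‖ₑ ^ 2) (coeZ μ)]
    simp only [add_sub_cancel_right]
    rw [← lintegral_comp_natCast_smul hN hu, ← lintegral_indicator measurableSet_unitBox]
    congr 1
    refine lintegral_congr fun t => ?_
    have ht : (N : ℝ)⁻¹ • (N : ℝ) • t = t := by rw [smul_smul, inv_mul_cancel₀ hN0, one_smul]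
    by_cases hb : t ∈ unitBox (Fin n)
    · rw [indicator_of_mem hb, window_of_mem (by rwa [ht]), enorm_eChar, one_mul]
    · rw [indicator_of_notMem hb, window_of_notMem (by rwa [ht]), enorm_zero, zero_mul]
  have hinj : Function.Injective fun ρ : Zn n => k + N • ρ := fun ρ ρ' hρ => by
    have := add_left_cancel hρ
    funext i
    have := congr_fun this i
    simpa [hN.ne'] using this
  simp only [freqCoeff_eq hN, enorm_mul, mul_pow, ENNReal.tsum_mul_left]
  rw [← hbox, ← mul_assoc]
  refine mul_le_mul' (le_of_eq ?_) (tsum_enorm_sq_unitBox_le hinj hmem)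
  rw [enorm_pow, sq]
  simp [← ofReal_norm]

lemma tsum_tsum_enorm_sq_freqCoeff_le (hN : 0 < N) {φ : Rn n → ℂ} (hφ : MemLp φ 2) (k : Zn n) :
    ∑' ρ, ∑' μ, ‖freqCoeff N φ k ρ μ‖ₑ ^ 2 ≤
      (N : ℝ≥0∞) ^ n * (((N + 1) ^ n : ℕ) * ∫⁻ ξ, ‖φ ξ‖ₑ ^ 2) := by
  rw [ENNReal.tsum_comm]
  refine (ENNReal.tsum_le_tsum fun μ => tsum_enorm_sq_freqCoeff_le hN hφ k μ).trans ?_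
  rw [ENNReal.tsum_mul_left]
  gcongr
  exact tsum_lintegral_window_le hN 0 (hφ.1.enorm.pow_const 2)

end FrequencyCoefficients

section BilinearExpansion

variable {n N : ℕ} {A : Zn n → Zn n → ℂ} {Φ : Rn n × Rn n → ℂ} {φ γ : Rn n → ℂ} {D : Zn n → ℝ}
  {C : ℝ} {x : Rn n} {c : Zn n → Zn n → ℂ}

/-- The terms, indexed by `((μ, ν), (k, l))`, of the expansion of the integrand defining the
bilinear operator at the point `x + ρ`. -/
noncomputable def expansionTerm (N : ℕ) (A : Zn n → Zn n → ℂ) (c : Zn n → Zn n → ℂ)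
    (φ γ : Rn n → ℂ) (x : Rn n) (ρ : Zn n) (q : (Zn n × Zn n) × (Zn n × Zn n))
    (p : Rn n × Rn n) : ℂ :=
  (A q.1.1 q.1.2 * eChar (intDot (q.1.1 + q.1.2) x) * c q.2.1 q.2.2) *
    (windowed N φ q.2.1 ρ q.1.1 p.1 * windowed N γ q.2.2 ρ q.1.2 p.2)

lemma norm_expansionTerm_le (hA : ∀ μ ν, ‖A μ ν‖ ≤ C) (hc : ∀ k l, ‖c k l‖ ≤ D k * D l)
    (ρ : Zn n) (q : (Zn n × Zn n) × (Zn n × Zn n)) (p : Rn n × Rn n) :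
    ‖expansionTerm N A c φ γ x ρ q p‖ ≤
      (C * (D q.2.1 * D q.2.2)) * ((‖window N 0 (p.1 - coeZ q.1.1)‖ * ‖φ p.1‖) *
        (‖window N 0 (p.2 - coeZ q.1.2)‖ * ‖γ p.2‖)) := by
  have hC : 0 ≤ C := (norm_nonneg _).trans (hA 0 0)
  simp only [expansionTerm, norm_mul, norm_windowed, norm_eChar, mul_one]
  gcongr
  exacts [hA _ _, hc _ _]

lemma summable_majorant (hD0 : ∀ k, 0 ≤ D k) (hD : Summable D) {a b : Zn n → ℝ}
    (ha0 : ∀ μ, 0 ≤ a μ) (hb0 : ∀ μ, 0 ≤ b μ) (ha : Summable a) (hb : Summable b) (C : ℝ) :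
    Summable fun q : (Zn n × Zn n) × (Zn n × Zn n) =>
      (C * (D q.2.1 * D q.2.2)) * (a q.1.1 * b q.1.2) := by
  have h1 := ha.mul_of_nonneg hb ha0 hb0
  have h2 := (hD.mul_of_nonneg hD hD0 hD0).mul_left C
  refine ((h1.norm.mul_norm h2.norm).of_norm).congr fun q => ?_
  ring

lemma integrable_expansionTerm (hφ : Integrable φ) (hγ : Integrable γ) (ρ : Zn n)
    (q : (Zn n × Zn n) × (Zn n × Zn n)) : Integrable (expansionTerm N A c φ γ x ρ q) :=
  ((integrable_windowed hφ q.2.1 ρ q.1.1).mul_prod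
    (integrable_windowed hγ q.2.2 ρ q.1.2)).const_mul _

lemma integral_expansionTerm (ρ : Zn n) (q : (Zn n × Zn n) × (Zn n × Zn n)) :
    ∫ p, expansionTerm N A c φ γ x ρ q p =
      (A q.1.1 q.1.2 * eChar (intDot (q.1.1 + q.1.2) x) * c q.2.1 q.2.2) *
        (freqCoeff N φ q.2.1 ρ q.1.1 * freqCoeff N γ q.2.2 ρ q.1.2) := by
  simp only [expansionTerm]
  rw [integral_const_mul, Measure.volume_eq_prod, integral_prod_mul]
  rfl

lemma summable_integral_norm_expansionTerm (hN : 0 < N) (hA : ∀ μ ν, ‖A μ ν‖ ≤ C)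
    (hD0 : ∀ k, 0 ≤ D k) (hD : Summable D) (hc : ∀ k l, ‖c k l‖ ≤ D k * D l)
    (hφ : Integrable φ) (hγ : Integrable γ) (ρ : Zn n) :
    Summable fun q => ∫ p, ‖expansionTerm N A c φ γ x ρ q p‖ := by
  refine Summable.of_nonneg_of_le (fun _ => integral_nonneg fun _ => norm_nonneg _) (fun q => ?_)
    (summable_majorant hD0 hD (fun _ => integral_nonneg fun _ => by positivity)
      (fun _ => integral_nonneg fun _ => by positivity)
      (summable_integral_norm_windowed hN hφ) (summable_integral_norm_windowed hN hγ) C)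
  rw [← integral_prod_mul, ← integral_const_mul, Measure.volume_eq_prod]
  have hw : ∀ {u : Rn n → ℂ}, Integrable u → ∀ μ : Zn n,
      Integrable fun ξ => ‖window N 0 (ξ - coeZ μ)‖ * ‖u ξ‖ := fun hu μ =>
    (integrable_windowed hu 0 0 μ).norm.congr (.of_forall fun ξ => norm_windowed _ _ _ _ _)
  exact integral_mono (integrable_expansionTerm hφ hγ ρ q).norm
    (((hw hφ _).mul_prod (hw hγ _)).const_mul _) (norm_expansionTerm_le hA hc ρ q)

lemma hasSum_expansionTerm (hN : 0 < N) (hA : ∀ μ ν, ‖A μ ν‖ ≤ C)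
    (hD0 : ∀ k, 0 ≤ D k) (hD : Summable D) (hc : ∀ k l, ‖c k l‖ ≤ D k * D l) (ρ : Zn n)
    (p : Rn n × Rn n)
    (hexp : ∀ μ ν : Zn n, HasSum (fun kl : Zn n × Zn n => c kl.1 kl.2 *
        (window N kl.1 (p.1 - coeZ μ) * window N kl.2 (p.2 - coeZ ν)))
      (eChar (∑ i, x i * ((p.1 - coeZ μ) i + (p.2 - coeZ ν) i)) *
        Φ (p.1 - coeZ μ, p.2 - coeZ ν))) :
    ∑' q, expansionTerm N A c φ γ x ρ q p =
      eChar (∑ i, (x + coeZ ρ) i * (p.1 i + p.2 i)) * sigmaA A Φ p * φ p.1 * γ p.2 := by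
  have hs : Summable fun q => expansionTerm N A c φ γ x ρ q p :=
    Summable.of_norm_bounded (summable_majorant hD0 hD (fun _ => by positivity)
      (fun _ => by positivity) ((summable_norm_window hN 0 p.1).mul_right ‖φ p.1‖)
      ((summable_norm_window hN 0 p.2).mul_right ‖γ p.2‖) C) (norm_expansionTerm_le hA hc ρ · p)
  have hfib := hs.hasSum.prod_fiberwise (g := fun μν : Zn n × Zn n =>
    eChar (∑ i, (x + coeZ ρ) i * (p.1 i + p.2 i)) *
      (A μν.1 μν.2 * Φ (p.1 - coeZ μν.1, p.2 - coeZ μν.2)) * φ p.1 * γ p.2) fun μν => by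
    have h := (hexp μν.1 μν.2).mul_left (A μν.1 μν.2 * eChar (intDot (μν.1 + μν.2) x) *
      (eChar (intDot ρ p.1) * φ p.1) * (eChar (intDot ρ p.2) * γ p.2))
    have he : eChar (∑ i, (x + coeZ ρ) i * (p.1 i + p.2 i)) =
        eChar (intDot (μν.1 + μν.2) x) * eChar (intDot ρ p.1) * eChar (intDot ρ p.2) *
          eChar (∑ i, x i * ((p.1 - coeZ μν.1) i + (p.2 - coeZ μν.2) i)) := by
      simp only [← eChar_add, intDot, ← Finset.sum_add_distrib]
      congr 1
      refine Finset.sum_congr rfl fun i _ => ?_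
      simp [coeZ]; ring
    have hterm : (fun kl => expansionTerm N A c φ γ x ρ (μν, kl) p) = _ := funext fun kl =>
      show _ = A μν.1 μν.2 * eChar (intDot (μν.1 + μν.2) x) * (eChar (intDot ρ p.1) * φ p.1) *
        (eChar (intDot ρ p.2) * γ p.2) * (c kl.1 kl.2 *
          (window N kl.1 (p.1 - coeZ μν.1) * window N kl.2 (p.2 - coeZ μν.2))) by
        simp only [expansionTerm, windowed]; ring
    rw [hterm, he]
    exact (congrArg (HasSum _) (by ring)).mp h
  rw [← hfib.tsum_eq, tsum_mul_right, tsum_mul_right, tsum_mul_left]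
  rfl

/-- The value of the bilinear operator at `x + ρ` is dominated by a convergent combination of
bilinear trigonometric series in `x`. -/
lemma enorm_bilinear_le (hN : 0 < N) (hA : ∀ μ ν, ‖A μ ν‖ ≤ C)
    (hD0 : ∀ k, 0 ≤ D k) (hD : Summable D) (hc : ∀ k l, ‖c k l‖ ≤ D k * D l)
    (hexp : ∀ᵐ p : Rn n × Rn n, HasSum (fun kl : Zn n × Zn n =>
          c kl.1 kl.2 * (window N kl.1 p.1 * window N kl.2 p.2))
          (eChar (∑ i, x i * (p.1 i + p.2 i)) * Φ p))
    (hφ : Integrable φ) (hγ : Integrable γ) (ρ : Zn n) :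
    ‖∫ p : Rn n × Rn n, eChar (∑ i, (x + coeZ ρ) i * (p.1 i + p.2 i)) * sigmaA A Φ p *
        φ p.1 * γ p.2‖ₑ ≤
      ∑' kl : Zn n × Zn n, ENNReal.ofReal (D kl.1) * ENNReal.ofReal (D kl.2) *
        ‖∑' μν : Zn n × Zn n, A μν.1 μν.2 * freqCoeff N φ kl.1 ρ μν.1 *
          freqCoeff N γ kl.2 ρ μν.2 * eChar (intDot (μν.1 + μν.2) x)‖ₑ := by
  have hexp' : ∀ᵐ p : Rn n × Rn n, ∀ μν : Zn n × Zn n,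
      HasSum (fun kl : Zn n × Zn n => c kl.1 kl.2 *
        (window N kl.1 (p.1 - coeZ μν.1) * window N kl.2 (p.2 - coeZ μν.2)))
      (eChar (∑ i, x i * ((p.1 - coeZ μν.1) i + (p.2 - coeZ μν.2) i)) *
        Φ (p.1 - coeZ μν.1, p.2 - coeZ μν.2)) := ae_all_iff.2 fun μν => by
    have : (volume : Measure (Rn n × Rn n)).IsAddHaarMeasure :=
      Measure.prod.instIsAddHaarMeasure volume volume
    have := (measurePreserving_sub_right (volume : Measure (Rn n × Rn n))
      (coeZ μν.1, coeZ μν.2)).quasiMeasurePreserving.ae hexp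
    exact this
  have hsum := hasSum_integral_of_summable_integral_norm
    (integrable_expansionTerm (N := N) (A := A) (c := c) (x := x) hφ hγ ρ)
    (summable_integral_norm_expansionTerm hN hA hD0 hD hc hφ hγ ρ)
  have hint : ∫ p : Rn n × Rn n, eChar (∑ i, (x + coeZ ρ) i * (p.1 i + p.2 i)) * sigmaA A Φ p *
        φ p.1 * γ p.2 = ∫ p, ∑' q, expansionTerm N A c φ γ x ρ q p := by
    refine integral_congr_ae ?_
    filter_upwards [hexp'] with p hp
    exact (hasSum_expansionTerm hN hA hD0 hD hc ρ p fun μ ν => hp (μ, ν)).symm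
  rw [hint, ← hsum.tsum_eq, ← (Equiv.prodComm _ _).tsum_eq]
  have hsum' : Summable fun q : (Zn n × Zn n) × (Zn n × Zn n) =>
      ∫ p, expansionTerm N A c φ γ x ρ (Equiv.prodComm _ _ q) p :=
    (Equiv.prodComm _ _).summable_iff.2 hsum.summable
  rw [hsum'.tsum_prod]
  refine (enorm_tsum_le_tsum_enorm).trans (ENNReal.tsum_le_tsum fun kl => ?_)
  have : ∀ μν : Zn n × Zn n, (∫ p, expansionTerm N A c φ γ x ρ (μν, kl) p) =
      c kl.1 kl.2 * (A μν.1 μν.2 * freqCoeff N φ kl.1 ρ μν.1 *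
          freqCoeff N γ kl.2 ρ μν.2 * eChar (intDot (μν.1 + μν.2) x)) := fun μν => by
    rw [integral_expansionTerm]; ring
  simp only [Equiv.prodComm_apply, Prod.swap_prod_mk, this]
  rw [tsum_mul_left, enorm_mul, ← ENNReal.ofReal_mul (hD0 _), ← ofReal_norm (c _ _)]
  gcongr
  exact hc _ _

end BilinearExpansion

lemma ENNReal.tsum_mul_le_sqrt_mul_sqrt {ι : Type*} (f g : ι → ℝ≥0∞) :
    ∑' i, f i * g i ≤ (∑' i, f i ^ 2) ^ (1 / 2 : ℝ) * (∑' i, g i ^ 2) ^ (1 / 2 : ℝ) := by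
  let _ : MeasurableSpace ι := ⊤
  have h := ENNReal.lintegral_mul_le_Lp_mul_Lq (Measure.count : Measure ι) .two_two
    (f := f) (g := g) (measurable_from_top.aemeasurable) (measurable_from_top.aemeasurable)
  simpa [lintegral_count] using h

lemma ENNReal.sq_tsum_mul_le {ι : Type*} (w a : ι → ℝ≥0∞) :
    (∑' i, w i * a i) ^ 2 ≤ (∑' i, w i) * ∑' i, w i * a i ^ 2 := by
  have hw : ∀ i, (w i ^ (1 / 2 : ℝ)) ^ 2 = w i := fun i => by
    rw [← ENNReal.rpow_mul_natCast]; norm_num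
  have h := ENNReal.tsum_mul_le_sqrt_mul_sqrt (fun i => w i ^ (1 / 2 : ℝ))
    fun i => w i ^ (1 / 2 : ℝ) * a i
  simp only [mul_pow, hw, ← mul_assoc, ← sq] at h
  calc _ ≤ _ := pow_le_pow_left' h 2
    _ = _ := by
      rw [mul_pow, ← ENNReal.rpow_mul_natCast, ← ENNReal.rpow_mul_natCast]; norm_num

section Estimate

variable {n N : ℕ} {A : Zn n → Zn n → ℂ} {Φ : Rn n × Rn n → ℂ} {φ γ : Rn n → ℂ} {D : Zn n → ℝ}
  {C : ℝ}

lemma continuous_bilinear_series (hA : ∀ μ ν, ‖A μ ν‖ ≤ C) {F G : Zn n → ℂ}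
    (hF : Summable fun μ => ‖F μ‖) (hG : Summable fun ν => ‖G ν‖) :
    Continuous fun x : Rn n => ∑' p : Zn n × Zn n,
      A p.1 p.2 * F p.1 * G p.2 * eChar (intDot (p.1 + p.2) x) :=
  continuous_tsum (fun p => by fun_prop) (summable_bilinear hA hF hG) fun p x => by simp

lemma localL2_le_of_enorm_le (hN : 0 < N) (hA : ∀ μ ν, ‖A μ ν‖ ≤ C)
    (hφ : Integrable φ) (hγ : Integrable γ) {T : Rn n → ℂ} (d : Zn n → ℝ≥0∞) (ρ : Zn n)
    (hT : ∀ x ∈ unitBox (Fin n), ‖T (x + coeZ ρ)‖ₑ ≤ ∑' kl : Zn n × Zn n, d kl.1 * d kl.2 *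
      ‖∑' μν : Zn n × Zn n, A μν.1 μν.2 * freqCoeff N φ kl.1 ρ μν.1 *
        freqCoeff N γ kl.2 ρ μν.2 * eChar (intDot (μν.1 + μν.2) x)‖ₑ) :
    localL2 T ρ ≤ (∑' k, d k) * normB A *
      ((∑' k, d k * ∑' μ, ‖freqCoeff N φ k ρ μ‖ₑ ^ 2) ^ (1 / 2 : ℝ) *
        (∑' l, d l * ∑' ν, ‖freqCoeff N γ l ρ ν‖ₑ ^ 2) ^ (1 / 2 : ℝ)) := by
  set S := ∑' k, d k with hS
  set X := fun k => ∑' μ, ‖freqCoeff N φ k ρ μ‖ₑ ^ 2 with hX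
  set Y := fun l => ∑' ν, ‖freqCoeff N γ l ρ ν‖ₑ ^ 2 with hY
  set P : Zn n × Zn n → Rn n → ℂ := fun kl x => ∑' μν : Zn n × Zn n,
    A μν.1 μν.2 * freqCoeff N φ kl.1 ρ μν.1 * freqCoeff N γ kl.2 ρ μν.2 *
      eChar (intDot (μν.1 + μν.2) x) with hP
  have hprod : ∀ a b : Zn n → ℝ≥0∞, ∑' kl : Zn n × Zn n, a kl.1 * b kl.2 =
      (∑' k, a k) * ∑' l, b l := fun a b => by
    rw [ENNReal.tsum_prod', ← ENNReal.tsum_mul_right]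
    simp only [ENNReal.tsum_mul_left]
  have hPm : ∀ kl, Measurable (P kl) := fun kl => (continuous_bilinear_series hA
    (summable_norm_freqCoeff hN hφ kl.1 ρ) (summable_norm_freqCoeff hN hγ kl.2 ρ)).measurable
  have hsq : ∫⁻ x in unitBox (Fin n), ‖T (x + coeZ ρ)‖ₑ ^ 2 ≤
      (S * normB A) ^ 2 * ((∑' k, d k * X k) * ∑' l, d l * Y l) := by
    calc ∫⁻ x in unitBox (Fin n), ‖T (x + coeZ ρ)‖ₑ ^ 2
        ≤ ∫⁻ x in unitBox (Fin n), S ^ 2 * ∑' kl, d kl.1 * d kl.2 * ‖P kl x‖ₑ ^ 2 := by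
          refine setLIntegral_mono' measurableSet_unitBox fun x hx => ?_
          refine (pow_le_pow_left' (hT x hx) 2).trans ?_
          refine (ENNReal.sq_tsum_mul_le (fun kl : Zn n × Zn n => d kl.1 * d kl.2)
            fun kl => ‖P kl x‖ₑ).trans_eq ?_
          rw [hprod, ← hS, ← sq]
      _ = S ^ 2 * ∑' kl, d kl.1 * d kl.2 * ∫⁻ x in unitBox (Fin n), ‖P kl x‖ₑ ^ 2 := by
          have hm : ∀ kl, Measurable fun x => ‖P kl x‖ₑ ^ 2 := fun kl =>
            (hPm kl).enorm.pow_const 2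
          rw [lintegral_const_mul _ (Measurable.tsum fun kl => (hm kl).const_mul _),
            lintegral_tsum fun kl => ((hm kl).const_mul _).aemeasurable]
          simp only [lintegral_const_mul _ (hm _)]
      _ ≤ S ^ 2 * ∑' kl : Zn n × Zn n,
            normB A ^ 2 * ((d kl.1 * X kl.1) * (d kl.2 * Y kl.2)) := by
          refine mul_le_mul_right (ENNReal.tsum_le_tsum fun kl => ?_) _
          refine (mul_le_mul_right (lintegral_bilinear_series_le hA
            (summable_norm_freqCoeff hN hφ kl.1 ρ)
            (summable_norm_freqCoeff hN hγ kl.2 ρ)) _).trans_eq ?_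
          simp only [hX, hY]; ring
      _ = _ := by
          rw [ENNReal.tsum_mul_left, hprod (fun k => d k * X k) fun l => d l * Y l]; ring
  have h := ENNReal.rpow_le_rpow hsq (show (0 : ℝ) ≤ 1 / 2 by norm_num)
  rw [ENNReal.mul_rpow_of_nonneg _ _ (by norm_num), ENNReal.mul_rpow_of_nonneg _ _ (by norm_num),
    ← ENNReal.rpow_natCast_mul, show ((2 : ℕ) : ℝ) * (1 / 2) = 1 by norm_num,
    ENNReal.rpow_one] at h
  exact h

lemma tsum_tsum_weighted_le (hN : 0 < N) (hφ : MemLp φ 2) (hφ1 : ∫⁻ ξ, ‖φ ξ‖ₑ ^ 2 = 1)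
    (d : Zn n → ℝ≥0∞) : ∑' ρ, ∑' k, d k * ∑' μ, ‖freqCoeff N φ k ρ μ‖ₑ ^ 2 ≤
      (∑' k, d k) * (N ^ n * (N + 1) ^ n : ℕ) := by
  rw [ENNReal.tsum_comm, ← ENNReal.tsum_mul_right]
  refine ENNReal.tsum_le_tsum fun k => ?_
  rw [ENNReal.tsum_mul_left]
  gcongr
  refine (tsum_tsum_enorm_sq_freqCoeff_le hN hφ k).trans_eq ?_
  rw [hφ1]; push_cast; ring

lemma tsum_localL2_le (hN : 0 < N) (hA : ∀ μ ν, ‖A μ ν‖ ≤ C)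
    (hφ : Integrable φ) (hγ : Integrable γ) (hφ2 : MemLp φ 2) (hγ2 : MemLp γ 2)
    (hφ1 : ∫⁻ ξ, ‖φ ξ‖ₑ ^ 2 = 1) (hγ1 : ∫⁻ ξ, ‖γ ξ‖ₑ ^ 2 = 1) {T : Rn n → ℂ} (d : Zn n → ℝ≥0∞)
    (hT : ∀ ρ, ∀ x ∈ unitBox (Fin n), ‖T (x + coeZ ρ)‖ₑ ≤
      ∑' kl : Zn n × Zn n, d kl.1 * d kl.2 *
        ‖∑' μν : Zn n × Zn n, A μν.1 μν.2 * freqCoeff N φ kl.1 ρ μν.1 *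
          freqCoeff N γ kl.2 ρ μν.2 * eChar (intDot (μν.1 + μν.2) x)‖ₑ) :
    ∑' ρ, localL2 T ρ ≤ (∑' k, d k) ^ 2 * (N ^ n * (N + 1) ^ n : ℕ) * normB A := by
  refine (ENNReal.tsum_le_tsum fun ρ =>
    localL2_le_of_enorm_le hN hA hφ hγ d ρ (hT ρ)).trans ?_
  rw [ENNReal.tsum_mul_left]
  set K : ℝ≥0∞ := (∑' k, d k) * (N ^ n * (N + 1) ^ n : ℕ) with hK
  have hsqrt : ∀ a : ℝ≥0∞, (a ^ (1 / 2 : ℝ)) ^ 2 = a := fun a => by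
    rw [← ENNReal.rpow_mul_natCast]; norm_num
  have h : ∑' ρ, ((∑' k, d k * ∑' μ, ‖freqCoeff N φ k ρ μ‖ₑ ^ 2) ^ (1 / 2 : ℝ) *
      (∑' l, d l * ∑' ν, ‖freqCoeff N γ l ρ ν‖ₑ ^ 2) ^ (1 / 2 : ℝ)) ≤ K := by
    refine (ENNReal.tsum_mul_le_sqrt_mul_sqrt _ _).trans ?_
    simp only [hsqrt]
    calc _ ≤ K ^ (1 / 2 : ℝ) * K ^ (1 / 2 : ℝ) := by
          gcongr
          exacts [tsum_tsum_weighted_le hN hφ2 hφ1 d, tsum_tsum_weighted_le hN hγ2 hγ1 d]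
      _ = K := by rw [← sq, hsqrt]
  refine (mul_le_mul_right h _).trans_eq ?_
  rw [hK]; ring

end Estimate

/-- For every `Φ ∈ C_c^∞(ℝ^n × ℝ^n)` there exists `c ∈ (0,∞)` depending only on
`n` and `Φ` such that `‖σ_{A,Φ}‖_{M(L²×L² → (L²,ℓ¹))} ≤ c ‖A‖_B` for all `L^∞` matrices `A`. -/
theorem statement0 (n : ℕ) (Φ : Rn n × Rn n → ℂ) (hΦ : IsCcInfty Φ) :
    ∃ c : ℝ≥0∞, 0 < c ∧ c < ∞ ∧
      ∀ A : Zn n → Zn n → ℂ, IsLinftyMatrix A →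
        multNorm 1 (sigmaA A Φ) ≤ c * normB A := by
  obtain ⟨N, hN, D, hD0, hD, hexp⟩ := exists_window_expansion hΦ
  have hS : ∑' k, ENNReal.ofReal (D k) ≠ ∞ := hD.tsum_ofReal_ne_top
  refine ⟨(∑' k, ENNReal.ofReal (D k)) ^ 2 * (N ^ n * (N + 1) ^ n : ℕ) + 1, by positivity,
    by finiteness, fun A ⟨C, hA⟩ => ?_⟩
  refine iSup_le fun f => iSup_le fun g => iSup_le fun hf => iSup_le fun hg => ?_
  obtain ⟨φ, hφ, hφ1⟩ := exists_schwartzMap_ft f hf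
  obtain ⟨γ, hγ, hγ1⟩ := exists_schwartzMap_ft g hg
  rw [amalgamNorm, if_neg ENNReal.one_ne_top]
  simp only [ENNReal.toReal_one, ENNReal.rpow_one, div_one]
  refine (tsum_localL2_le hN hA φ.integrable γ.integrable (φ.memLp 2) (γ.memLp 2) hφ1 hγ1
    (fun k => ENNReal.ofReal (D k)) fun ρ x hx => ?_).trans (by gcongr; exact le_self_add)
  obtain ⟨c, hc, hcx⟩ := hexp x hx
  have := enorm_bilinear_le hN hA hD0 hD hc hcx φ.integrable γ.integrable ρ
  simpa only [Tbil, hφ, hγ, eChar] using this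
end

section
/- If Φ ∈ C_c^∞(ℝ^n × ℝ^n) satisfies condition (A) (with d = 2n), then there exists a constant c ∈ (0,∞), depending only on n and Φ, such that for every L^∞ matrix A = (a_{μν})_{μ,ν∈ℤ^n} one has ‖σ_{A,Φ}‖_{M(L²×L² → (L²,ℓ^∞))} ≥ c^{-1} ‖A‖_B. -/
open MeasureTheory Complex
open scoped ENNReal NNReal

theorem lintegral_le_tsum_cube {n : ℕ} (G : Rn n → ℝ≥0∞) :
    ∫⁻ x, G x ≤ ∑' ν : Zn n, ∫⁻ x in cube n 1, G (x + coeZ ν) := by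
  have hcover : (⋃ ν : Zn n, (fun x : Rn n => x - coeZ ν) ⁻¹' cube n 1) = Set.univ := by
    refine Set.eq_univ_of_forall fun x => Set.mem_iUnion.2 ⟨fun i => round (x i), ?_⟩
    intro i _
    have := abs_sub_round (x i)
    rw [abs_le] at this
    simp only [coeZ, Pi.sub_apply, Set.mem_Icc]
    constructor <;> linarith [this.1, this.2]
  calc ∫⁻ x, G x = ∫⁻ x in ⋃ ν : Zn n, (fun x : Rn n => x - coeZ ν) ⁻¹' cube n 1, G x := by
        rw [hcover, Measure.restrict_univ]
    _ ≤ ∑' ν : Zn n, ∫⁻ x in (fun x : Rn n => x - coeZ ν) ⁻¹' cube n 1, G x :=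
        lintegral_iUnion_le _ _
    _ = _ := by
        refine tsum_congr fun ν => ?_
        have := (measurePreserving_sub_right (volume : Measure (Rn n)) (coeZ
          ν)).setLIntegral_comp_preimage_emb
          (MeasurableEquiv.subRight (coeZ ν)).measurableEmbedding (fun x => G (x + coeZ ν)) (cube n 1)
        simpa using this

theorem tsum_setLIntegral_cube_le {n : ℕ} (G : Rn n → ℝ≥0∞) :
    ∑' ν : Zn n, ∫⁻ x in cube n 1, G (x + coeZ ν) ≤ ∫⁻ x, G x := by
  set S : Set (Rn n) := Set.univ.pi fun _ => Set.Ico (-1 / 2 : ℝ) (1 / 2) with hS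
  have hSm : MeasurableSet S := MeasurableSet.univ_pi fun _ => measurableSet_Ico
  have hae : (cube n 1 : Set (Rn n)) =ᵐ[volume] S := by
    have := (Measure.univ_pi_Ico_ae_eq_Icc (μ := fun _ : Fin n => (volume : Measure ℝ))
      (f := fun _ => (-1 / 2 : ℝ)) (g := fun _ => (1 / 2 : ℝ)))
    rw [← Set.pi_univ_Icc] at this
    exact this.symm
  have hdisj : Pairwise (Function.onFun Disjoint
      fun ν : Zn n => (fun x : Rn n => x - coeZ ν) ⁻¹' S) := by
    intro ν ν' hne
    refine Set.disjoint_left.2 fun x hx hx' => hne (funext fun i => ?_)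
    have h1 := hx i trivial
    have h2 := hx' i trivial
    simp only [coeZ, Pi.sub_apply, Set.mem_Ico] at h1 h2
    have h3 : (ν i : ℝ) < ν' i + 1 := by linarith [h1.1, h2.2]
    have h4 : (ν' i : ℝ) < ν i + 1 := by linarith [h1.2, h2.1]
    have h5 : ν i < ν' i + 1 := by exact_mod_cast h3
    have h6 : ν' i < ν i + 1 := by exact_mod_cast h4
    omega
  calc ∑' ν : Zn n, ∫⁻ x in cube n 1, G (x + coeZ ν)
      = ∑' ν : Zn n, ∫⁻ x in (fun x : Rn n => x - coeZ ν) ⁻¹' S, G x := by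
        refine tsum_congr fun ν => ?_
        have := (measurePreserving_sub_right (volume : Measure (Rn n)) (coeZ
          ν)).setLIntegral_comp_preimage_emb
          (MeasurableEquiv.subRight (coeZ ν)).measurableEmbedding (fun x => G (x + coeZ ν)) S
        rw [setLIntegral_congr hae]
        simpa using this.symm
    _ = ∫⁻ x in ⋃ ν : Zn n, (fun x : Rn n => x - coeZ ν) ⁻¹' S, G x := by
        rw [lintegral_iUnion (fun ν => (measurable_sub_const _) hSm) hdisj]
    _ ≤ _ := setLIntegral_le_lintegral _ _

theorem norm_le_of_mem_cube {n : ℕ} {x : Rn n} (hx : x ∈ cube n 1) : ‖x‖ ≤ 1 / 2 := by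
  refine (pi_norm_le_iff_of_nonneg (by norm_num)).2 fun i => ?_
  have := hx i trivial
  rw [Real.norm_eq_abs, abs_le]
  constructor <;> linarith [this.1, this.2]

theorem volume_cube (n : ℕ) : volume (cube n 1) = 1 := by
  rw [cube, Set.pi_univ_Icc, Real.volume_Icc_pi]
  norm_num

theorem measurableSet_cube (n : ℕ) (a : ℝ) : MeasurableSet (cube n a) :=
  MeasurableSet.univ_pi fun _ => measurableSet_Icc

/-- Schwartz functions belong to the Wiener amalgam space `(L^∞, ℓ¹)`. -/
theorem tsum_iSup_cube_lt_top {n : ℕ} (β : SchwartzMap (Rn n) ℂ) :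
    ∑' ν : Zn n, ⨆ x ∈ cube n 1, ‖β (x + coeZ ν)‖ₑ < ∞ := by
  obtain ⟨C, hC⟩ : ∃ C : ℝ, ∀ x, (1 + ‖x‖) ^ (n + 1) * ‖β x‖ ≤ C := by
    refine ⟨2 ^ (n + 1) * ((Finset.Iic (n + 1, 0)).sup fun m => SchwartzMap.seminorm ℝ m.1 m.2) β,
      fun x => ?_⟩
    have := SchwartzMap.one_add_le_sup_seminorm_apply (𝕜 := ℝ) (m := (n + 1, 0)) (le_refl (n + 1))
      (le_refl 0) β x
    simpa using this
  have hC0 : 0 ≤ C := le_trans (by positivity) (hC 0)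
  set w : Rn n → ℝ := fun x => (1 + ‖x‖) ^ (-((n + 1 : ℕ) : ℝ)) with hw
  have hwi : Integrable w := integrable_one_add_norm (by simp)
  have hkey : ∀ x ∈ cube n 1, ∀ y ∈ cube n 1, ∀ ν : Zn n,
      ‖β (x + coeZ ν)‖ₑ ≤ ENNReal.ofReal (C * 2 ^ (n + 1)) * ENNReal.ofReal (w (y + coeZ ν)) := by
    intro x hx y hy ν
    rw [← ofReal_norm, ← ENNReal.ofReal_mul (by positivity)]
    refine ENNReal.ofReal_le_ofReal ?_
    have h1 : 1 + ‖y + coeZ ν‖ ≤ 2 * (1 + ‖x + coeZ ν‖) := by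
      have : y + coeZ ν = (x + coeZ ν) + (y - x) := by abel
      have h2 : ‖y + coeZ ν‖ ≤ ‖x + coeZ ν‖ + (‖y‖ + ‖x‖) := by
        rw [this]
        exact (norm_add_le _ _).trans (by gcongr; exact norm_sub_le _ _)
      linarith [norm_le_of_mem_cube hx, norm_le_of_mem_cube hy, norm_nonneg (x + coeZ ν)]
    have hw' : w (y + coeZ ν) = ((1 + ‖y + coeZ ν‖) ^ (n + 1))⁻¹ := by
      simp only [hw]
      rw [Real.rpow_neg (by positivity), Real.rpow_natCast]
    rw [hw', ← div_eq_mul_inv, le_div_iff₀ (by positivity)]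
    calc ‖β (x + coeZ ν)‖ * (1 + ‖y + coeZ ν‖) ^ (n + 1)
        ≤ ‖β (x + coeZ ν)‖ * (2 * (1 + ‖x + coeZ ν‖)) ^ (n + 1) := by gcongr
      _ = 2 ^ (n + 1) * ((1 + ‖x + coeZ ν‖) ^ (n + 1) * ‖β (x + coeZ ν)‖) := by
          rw [mul_pow]; ring
      _ ≤ 2 ^ (n + 1) * C := by gcongr; exact hC _
      _ = _ := by ring
  calc ∑' ν : Zn n, ⨆ x ∈ cube n 1, ‖β (x + coeZ ν)‖ₑ
      ≤ ∑' ν : Zn n, ∫⁻ y in cube n 1,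
          ENNReal.ofReal (C * 2 ^ (n + 1)) * ENNReal.ofReal (w (y + coeZ ν)) := by
        refine ENNReal.tsum_le_tsum fun ν => iSup₂_le fun x hx => ?_
        calc ‖β (x + coeZ ν)‖ₑ = ∫⁻ _ in cube n 1, ‖β (x + coeZ ν)‖ₑ := by
              rw [setLIntegral_const, volume_cube, mul_one]
          _ ≤ _ := setLIntegral_mono' (measurableSet_cube n 1) fun y hy => hkey x hx y hy ν
    _ ≤ ∫⁻ y, ENNReal.ofReal (C * 2 ^ (n + 1)) * ENNReal.ofReal (w y) :=
        tsum_setLIntegral_cube_le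
          (fun y => ENNReal.ofReal (C * 2 ^ (n + 1)) * ENNReal.ofReal (w y))
    _ < ∞ := by
        rw [lintegral_const_mul' _ _ ENNReal.ofReal_ne_top]
        exact ENNReal.mul_lt_top ENNReal.ofReal_lt_top hwi.lintegral_lt_top

/-- Parseval's inequality for trigonometric polynomials on the unit cube. -/
theorem lintegral_trigPoly_le {n : ℕ} (s : Finset (Zn n)) (a : Zn n → ℂ) :
    ∫⁻ x in cube n 1,
      ‖∑ μ ∈ s, a μ * cexp ((2 * Real.pi * I) * ((∑ i, x i * coeZ μ i : ℝ) : ℂ))‖ₑ ^ 2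
      ≤ ENNReal.ofReal (∑ μ ∈ s, ‖a μ‖ ^ 2) := by
  set e : Zn n → Rn n → ℂ :=
    fun μ x => cexp ((2 * Real.pi * I) * ((∑ i, x i * coeZ μ i : ℝ) : ℂ)) with he
  have hec : ∀ μ, Continuous (e μ) := fun μ => by simp only [he]; fun_prop
  have hcube : IsCompact (cube n 1) := isCompact_univ_pi fun _ => isCompact_Icc
  have horth : ∀ μ ν, ∫ x in cube n 1, e μ x * (starRingEnd ℂ) (e ν x) = if μ = ν then 1 else 0 := by
    intro μ ν
    have h1 : ∀ x : Rn n, e μ x * (starRingEnd ℂ) (e ν x) =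
        ∏ i, cexp ((2 * Real.pi * I * ((μ i - ν i : ℤ) : ℂ)) * (x i : ℂ)) := by
      intro x
      simp only [he]
      rw [← Complex.exp_conj, ← Complex.exp_add, ← Complex.exp_sum]
      congr 1
      simp only [map_mul, map_ofNat, conj_ofReal, conj_I, coeZ]
      push_cast
      rw [Finset.mul_sum, Finset.mul_sum, ← Finset.sum_add_distrib]
      exact Finset.sum_congr rfl fun i _ => by ring
    have h2 : ∀ k : ℤ, ∫ t in Set.Icc (-1 / 2 : ℝ) (1 / 2), cexp ((2 * Real.pi * I * (k : ℂ)) * (t : ℂ))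
        = if k = 0 then 1 else 0 := by
      intro k
      rw [integral_Icc_eq_integral_Ioc, ← intervalIntegral.integral_of_le (by norm_num)]
      split_ifs with hk
      · subst hk; norm_num
      · have hne : (2 * Real.pi * I * (k : ℂ)) ≠ 0 := by
          simp [Real.pi_ne_zero, hk]
        rw [integral_exp_mul_complex hne]
        have : cexp (2 * Real.pi * I * (k : ℂ) * ((1 / 2 : ℝ) : ℂ)) =
            cexp (2 * Real.pi * I * (k : ℂ) * ((-1 / 2 : ℝ) : ℂ)) := by
          rw [Complex.exp_eq_exp_iff_exists_int]
          exact ⟨k, by push_cast; ring⟩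
        rw [this, sub_self, zero_div]
    simp_rw [h1]
    have h3 : (volume : Measure (Rn n)).restrict (cube n 1) =
        Measure.pi fun _ : Fin n => (volume : Measure ℝ).restrict (Set.Icc (-1 / 2 : ℝ) (1 / 2)) := by
      rw [volume_pi, cube, Measure.restrict_pi_pi]
    rw [h3, integral_fintype_prod_eq_prod
      (f := fun i (t : ℝ) => cexp ((2 * Real.pi * I * ((μ i - ν i : ℤ) : ℂ)) * (t : ℂ)))]
    simp_rw [h2, sub_eq_zero]
    rw [Finset.prod_ite_zero]
    simp [funext_iff]
  have hint : ∀ μ ν, IntegrableOn (fun x => a μ * (starRingEnd ℂ) (a ν) *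
      (e μ x * (starRingEnd ℂ) (e ν x))) (cube n 1) := fun μ ν =>
    ContinuousOn.integrableOn_compact hcube (by
      refine Continuous.continuousOn ?_
      exact continuous_const.mul ((hec μ).mul (continuous_conj.comp (hec ν))))
  have hsq : ∀ x, (((‖∑ μ ∈ s, a μ * e μ x‖ ^ 2 : ℝ)) : ℂ) =
      ∑ μ ∈ s, ∑ ν ∈ s, a μ * (starRingEnd ℂ) (a ν) * (e μ x * (starRingEnd ℂ) (e ν x)) := by
    intro x
    rw [ofReal_pow, ← Complex.mul_conj', map_sum, Finset.sum_mul_sum]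
    refine Finset.sum_congr rfl fun μ _ => Finset.sum_congr rfl fun ν _ => ?_
    rw [map_mul]; ring
  have hI : ∫ x in cube n 1, ‖∑ μ ∈ s, a μ * e μ x‖ ^ 2 = ∑ μ ∈ s, ‖a μ‖ ^ 2 := by
    apply Complex.ofReal_injective
    rw [← integral_complex_ofReal]
    simp_rw [hsq]
    rw [integral_finsetSum _ fun μ _ => integrable_finsetSum _ fun ν _ => hint μ ν]
    rw [ofReal_sum]
    refine Finset.sum_congr rfl fun μ hμ => ?_
    rw [integral_finsetSum _ fun ν _ => hint μ ν]
    simp_rw [integral_const_mul, horth]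
    simp [hμ, Complex.mul_conj']
  have hcont : Continuous fun x => ∑ μ ∈ s, a μ * e μ x :=
    continuous_finsetSum _ fun μ _ => continuous_const.mul (hec μ)
  rw [← hI, ofReal_integral_eq_lintegral_ofReal]
  · refine lintegral_mono fun x => ?_
    rw [ENNReal.ofReal_pow (norm_nonneg _), ofReal_norm]
  · exact ContinuousOn.integrableOn_compact hcube (by fun_prop)
  · exact Filter.Eventually.of_forall fun x => by positivity

/-- Every test function is the Fourier transform of a Schwartz function, given by the inverse
Fourier integral. -/
theorem exists_schwartz_ft_eq {n : ℕ} {u : Rn n → ℂ} (hu : ContDiff ℝ (⊤ : ℕ∞) u)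
    (hu' : HasCompactSupport u) :
    ∃ f : SchwartzMap (Rn n) ℂ, (∀ ξ, ft f ξ = u ξ) ∧
      ∀ x, f x = ∫ ξ : Rn n, cexp ((2 * Real.pi * I) * ((∑ i, x i * ξ i : ℝ) : ℂ)) * u ξ := by
  open FourierTransform in
  set L : EuclideanSpace ℝ (Fin n) ≃L[ℝ] Rn n := PiLp.continuousLinearEquiv 2 ℝ fun _ => ℝ
  have hUc : HasCompactSupport (u ∘ L) := hu'.comp_homeomorph L.toHomeomorph
  set U : SchwartzMap (EuclideanSpace ℝ (Fin n)) ℂ :=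
    hUc.toSchwartzMap (hu.comp L.contDiff) with hU
  have hUa : ∀ y, U y = u (L y) := fun y => rfl
  set f : SchwartzMap (Rn n) ℂ := SchwartzMap.compCLMOfContinuousLinearEquiv ℝ L.symm (𝓕⁻ U)
  have hfa : ∀ x, f x = (𝓕⁻ U) (L.symm x) := fun x => rfl
  have hmp := PiLp.volume_preserving_ofLp (Fin n)
  have hemb : MeasurableEmbedding (@WithLp.ofLp 2 (Fin n → ℝ)) :=
    (MeasurableEquiv.toLp 2 (Fin n → ℝ)).symm.measurableEmbedding
  refine ⟨f, fun ξ => ?_, fun x => ?_⟩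
  · have h1 : 𝓕 (𝓕⁻ U) = U := FourierTransform.fourier_fourierInv_eq U
    have h2 : (𝓕 (𝓕⁻ U)) (L.symm ξ) = u ξ := by rw [h1, hUa]; simp
    rw [← h2, SchwartzMap.fourier_coe, Real.fourier_eq', ft, ← hmp.integral_comp hemb]
    refine integral_congr_ae (Filter.Eventually.of_forall fun y => ?_)
    simp only [hfa, smul_eq_mul]
    congr 2
    simp [L, PiLp.inner_apply, mul_comm]
    ring
  · rw [hfa, SchwartzMap.fourierInv_coe, Real.fourierInv_eq', ← hmp.integral_comp hemb]
    refine integral_congr_ae (Filter.Eventually.of_forall fun y => ?_)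
    simp only [hUa, smul_eq_mul]
    congr 2
    simp [L, PiLp.inner_apply, mul_comm]
    ring

theorem localL2_sq {n : ℕ} (h : Rn n → ℂ) (ν : Zn n) :
    localL2 h ν ^ 2 = ∫⁻ x in cube n 1, ‖h (x + coeZ ν)‖ₑ ^ 2 := by
  rw [localL2, ← ENNReal.rpow_natCast, ← ENNReal.rpow_mul]
  norm_num
  rfl

theorem localL2_le_of_lintegral_le {n : ℕ} {h : Rn n → ℂ} {ν : Zn n} {S : ℝ≥0∞}
    (hS : ∫⁻ x in cube n 1, ‖h (x + coeZ ν)‖ₑ ^ 2 ≤ S ^ 2) : localL2 h ν ≤ S := by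
  rw [← localL2_sq] at hS
  exact (ENNReal.pow_le_pow_left_iff two_ne_zero).1 hS

theorem hasCompactSupport_finsetSum {ι E : Type*} [TopologicalSpace E] (s : Finset ι)
    {u : ι → E → ℂ} (hu : ∀ i, HasCompactSupport (u i)) :
    HasCompactSupport fun x => ∑ i ∈ s, u i x := by
  induction s using Finset.cons_induction with
  | empty =>
    simp_rw [Finset.sum_empty]
    exact HasCompactSupport.zero
  | cons i s hi ih =>
    simp_rw [Finset.sum_cons]
    exact (hu i).add ih

/-- Modulated sums `∑ a_μ e^{2πi μ·x} β(x)`, whose Fourier transform is `∑ a_μ b(ξ - μ)`, have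
`(L², ℓ¹)` norm controlled by the `ℓ²` norm of the coefficients. -/
theorem exists_schwartz_ft_eq_sum_translate {n : ℕ} {b : Rn n → ℂ} (hb : ContDiff ℝ (⊤ : ℕ∞) b)
    (hb' : HasCompactSupport b) :
    ∃ C : ℝ≥0∞, C < ∞ ∧ ∀ (s : Finset (Zn n)) (a : Zn n → ℂ), ∑ μ ∈ s, ‖a μ‖ ^ 2 = 1 →
      ∃ f : SchwartzMap (Rn n) ℂ, (∀ ξ, ft f ξ = ∑ μ ∈ s, a μ * b (ξ - coeZ μ)) ∧
        ∑' ν, localL2 f ν ≤ C := by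
  obtain ⟨β, -, hβ⟩ := exists_schwartz_ft_eq hb hb'
  refine ⟨_, tsum_iSup_cube_lt_top β, fun s a ha => ?_⟩
  have hsmooth : ∀ μ : Zn n, ContDiff ℝ (⊤ : ℕ∞) fun ξ : Rn n => a μ * b (ξ - coeZ μ) := fun μ =>
    contDiff_const.mul (hb.comp (contDiff_id.sub contDiff_const))
  have hsupp : ∀ μ : Zn n, HasCompactSupport fun ξ : Rn n => a μ * b (ξ - coeZ μ) := fun μ =>
    (hb'.comp_homeomorph (Homeomorph.subRight (coeZ μ))).mul_left
  have hsupp' : HasCompactSupport fun ξ : Rn n => ∑ μ ∈ s, a μ * b (ξ - coeZ μ) :=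
    hasCompactSupport_finsetSum s hsupp
  obtain ⟨f, hf, hf'⟩ := exists_schwartz_ft_eq (ContDiff.sum fun μ _ => hsmooth μ) hsupp'
  refine ⟨f, hf, ENNReal.tsum_le_tsum fun ν => ?_⟩
  have hfactor : ∀ x, f x =
      (∑ μ ∈ s, a μ * cexp ((2 * Real.pi * I) * ((∑ i, x i * coeZ μ i : ℝ) : ℂ))) * β x := by
    intro x
    have hmod : Continuous fun ξ : Rn n =>
        cexp ((2 * Real.pi * I) * ((∑ i, x i * ξ i : ℝ) : ℂ)) := by fun_prop
    rw [hf', hβ, Finset.sum_mul]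
    simp_rw [Finset.mul_sum]
    rw [integral_finsetSum]
    · refine Finset.sum_congr rfl fun μ _ => ?_
      rw [← integral_const_mul, ← integral_add_right_eq_self _ (coeZ μ)]
      refine integral_congr_ae (Filter.Eventually.of_forall fun ξ => ?_)
      simp only [add_sub_cancel_right, Pi.add_apply, mul_add, Finset.sum_add_distrib, ofReal_add,
        Complex.exp_add]
      ring
    · intro μ _
      exact (hmod.mul (hsmooth μ).continuous).integrable_of_hasCompactSupport (hsupp μ).mul_left
  apply localL2_le_of_lintegral_le
  set S := ⨆ x ∈ cube n 1, ‖β (x + coeZ ν)‖ₑ with hS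
  calc ∫⁻ x in cube n 1, ‖f (x + coeZ ν)‖ₑ ^ 2
      ≤ ∫⁻ x in cube n 1, ‖∑ μ ∈ s,
          a μ * cexp ((2 * Real.pi * I) * ((∑ i, x i * coeZ μ i : ℝ) : ℂ))‖ₑ ^ 2 * S ^ 2 := by
        refine setLIntegral_mono' (measurableSet_cube n 1) fun x hx => ?_
        rw [hfactor, enorm_mul, mul_pow]
        have hper : ∀ μ : Zn n,
            cexp ((2 * Real.pi * I) * ((∑ i, (x + coeZ ν) i * coeZ μ i : ℝ) : ℂ)) =
            cexp ((2 * Real.pi * I) * ((∑ i, x i * coeZ μ i : ℝ) : ℂ)) := by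
          intro μ
          rw [Complex.exp_eq_exp_iff_exists_int]
          refine ⟨∑ i, ν i * μ i, ?_⟩
          simp only [Pi.add_apply, add_mul, Finset.sum_add_distrib, coeZ]
          push_cast
          ring
        simp_rw [hper]
        gcongr
        exact le_iSup₂ (f := fun x (_ : x ∈ cube n 1) => ‖β (x + coeZ ν)‖ₑ) x hx
    _ = (∫⁻ x in cube n 1, ‖∑ μ ∈ s,
          a μ * cexp ((2 * Real.pi * I) * ((∑ i, x i * coeZ μ i : ℝ) : ℂ))‖ₑ ^ 2) * S ^ 2 := by
        refine lintegral_mul_const _ (Continuous.measurable ?_)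
        fun_prop
    _ ≤ 1 * S ^ 2 := by
        gcongr
        exact (lintegral_trigPoly_le s a).trans (by simp [ha])
    _ = S ^ 2 := one_mul _

theorem eLpNorm_two_le_tsum_localL2 {n : ℕ} (f : Rn n → ℂ) :
    eLpNorm f 2 volume ≤ ∑' ν, localL2 f ν := by
  have h : eLpNorm f 2 volume ^ 2 ≤ (∑' ν, localL2 f ν) ^ 2 := by
    calc eLpNorm f 2 volume ^ 2 = ∫⁻ x, ‖f x‖ₑ ^ 2 := by
          rw [eLpNorm_eq_lintegral_rpow_enorm_toReal two_ne_zero ENNReal.ofNat_ne_top,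
            ← ENNReal.rpow_natCast, ← ENNReal.rpow_mul]
          norm_num
      _ ≤ ∑' ν, localL2 f ν ^ 2 := by
          simp_rw [localL2_sq]
          exact lintegral_le_tsum_cube fun x => ‖f x‖ₑ ^ 2
      _ ≤ ∑' ν, localL2 f ν * ∑' ν, localL2 f ν := by
          refine ENNReal.tsum_le_tsum fun ν => ?_
          rw [sq]
          gcongr
          exact ENNReal.le_tsum ν
      _ = _ := by rw [ENNReal.tsum_mul_right, sq]
  exact (ENNReal.pow_le_pow_left_iff two_ne_zero).1 h

/-- Hölder's inequality for the pairing of `(L², ℓ¹)` and `(L², ℓ^∞)`. -/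
theorem lintegral_mul_le_amalgamNorm {n : ℕ} {k h : Rn n → ℂ} (hk : Measurable k)
    (hh : Measurable h) :
    ∫⁻ x, ‖k x‖ₑ * ‖h x‖ₑ ≤ (∑' ν, localL2 k ν) * amalgamNorm ⊤ h := by
  refine (lintegral_le_tsum_cube _).trans ?_
  rw [← ENNReal.tsum_mul_right]
  refine ENNReal.tsum_le_tsum fun ν => ?_
  have hm : Measurable fun x : Rn n => x + coeZ ν := measurable_add_const _
  calc ∫⁻ x in cube n 1, ‖k (x + coeZ ν)‖ₑ * ‖h (x + coeZ ν)‖ₑ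
      ≤ localL2 k ν * localL2 h ν := by
        have := ENNReal.lintegral_mul_le_Lp_mul_Lq (volume.restrict (cube n 1))
          Real.HolderConjugate.two_two (hk.comp hm).enorm.aemeasurable
          (hh.comp hm).enorm.aemeasurable
        simpa [localL2, enorm_eq_nnnorm] using this
    _ ≤ _ := by
        gcongr
        rw [amalgamNorm, if_pos rfl]
        exact le_iSup (localL2 h) ν

theorem ft_smul {n : ℕ} (c : ℂ) (f : SchwartzMap (Rn n) ℂ) (ξ : Rn n) :
    ft (c • f) ξ = c * ft f ξ := by
  simp only [ft, smul_apply, smul_eq_mul]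
  rw [← integral_const_mul]
  congr 1
  ext x
  ring

theorem Tbil_smul_smul {n : ℕ} (σ : Rn n × Rn n → ℂ) (c d : ℂ) (f g : SchwartzMap (Rn n) ℂ) :
    Tbil σ (c • f) (d • g) = fun x => c * d * Tbil σ f g x := by
  ext x
  simp only [Tbil, ft_smul]
  rw [← integral_const_mul]
  congr 1
  ext p
  ring

theorem amalgamNorm_top_const_mul {n : ℕ} (c : ℂ) (h : Rn n → ℂ) :
    amalgamNorm ⊤ (fun x => c * h x) = ‖c‖ₑ * amalgamNorm ⊤ h := by
  simp only [amalgamNorm, if_true, ENNReal.mul_iSup]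
  refine iSup_congr fun ν => ?_
  have : (localL2 (fun x => c * h x) ν) ^ 2 = (‖c‖ₑ * localL2 h ν) ^ 2 := by
    rw [mul_pow, localL2_sq, localL2_sq, ← lintegral_const_mul' _ _ (by simp)]
    simp_rw [enorm_mul, mul_pow]
  exact le_antisymm ((ENNReal.pow_le_pow_left_iff two_ne_zero).1 this.le)
    ((ENNReal.pow_le_pow_left_iff two_ne_zero).1 this.ge)

theorem amalgamNorm_Tbil_le {n : ℕ} (σ : Rn n × Rn n → ℂ) (f g : SchwartzMap (Rn n) ℂ) :
    amalgamNorm ⊤ (Tbil σ f g) ≤ multNorm ⊤ σ * (eLpNorm f 2 volume * eLpNorm g 2 volume) := by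
  have hzero : ∀ f : SchwartzMap (Rn n) ℂ, eLpNorm f 2 volume = 0 → ft f = 0 := by
    intro f hf
    rw [eLpNorm_eq_zero_iff f.continuous.aestronglyMeasurable two_ne_zero] at hf
    ext ξ
    rw [ft, integral_eq_zero_of_ae]
    · rfl
    · filter_upwards [hf] with x hx
      simp [hx]
  have hzero' : amalgamNorm ⊤ (0 : Rn n → ℂ) = 0 := by
    simpa [Pi.zero_def] using amalgamNorm_top_const_mul 0 (0 : Rn n → ℂ)
  by_cases hf : eLpNorm f 2 volume = 0
  · have : Tbil σ f g = 0 := by ext x; simp [Tbil, hzero f hf]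
    rw [this, hzero']
    exact zero_le
  by_cases hg : eLpNorm g 2 volume = 0
  · have : Tbil σ f g = 0 := by ext x; simp [Tbil, hzero g hg]
    rw [this, hzero']
    exact zero_le
  have hnorm : ∀ f : SchwartzMap (Rn n) ℂ, eLpNorm f 2 volume ≠ 0 →
      ∃ (c : ℂ) (f₁ : SchwartzMap (Rn n) ℂ), f = c • f₁ ∧ eLpNorm f₁ 2 volume = 1 ∧ ‖c‖ₑ = eLpNorm f 2 volume := by
    intro f hf
    have hft : eLpNorm f 2 volume ≠ ∞ := (f.memLp 2 volume).eLpNorm_ne_top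
    set r := (eLpNorm f 2 volume).toReal with hr
    have hr0 : 0 < r := ENNReal.toReal_pos hf hft
    have hre : ‖(r : ℂ)‖ₑ = eLpNorm f 2 volume := by
      rw [← ofReal_norm, Complex.norm_real, Real.norm_of_nonneg hr0.le, hr, ENNReal.ofReal_toReal hft]
    have hrc : (r : ℂ) ≠ 0 := by exact_mod_cast hr0.ne'
    refine ⟨r, (r : ℂ)⁻¹ • f, ?_, ?_, hre⟩
    · rw [smul_smul, mul_inv_cancel₀ hrc, one_smul]
    · change eLpNorm ((r : ℂ)⁻¹ • (f : Rn n → ℂ)) 2 volume = 1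
      rw [eLpNorm_const_smul, enorm_inv hrc, hre, ENNReal.inv_mul_cancel hf hft]
  obtain ⟨c, f₁, rfl, hf₁, hc⟩ := hnorm f hf
  obtain ⟨d, g₁, rfl, hg₁, hd⟩ := hnorm g hg
  rw [← hc, ← hd, Tbil_smul_smul, amalgamNorm_top_const_mul, enorm_mul, mul_comm]
  gcongr
  exact le_iSup₂_of_le f₁ g₁ (le_iSup₂_of_le hf₁ hg₁ le_rfl)

theorem enorm_integral_mul_ft_le {n : ℕ} {σ : Rn n × Rn n → ℂ} (hσ : Continuous σ)
    (f g k : SchwartzMap (Rn n) ℂ) (hf : Continuous (ft f)) (hf' : HasCompactSupport (ft f))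
    (hg : Continuous (ft g)) (hg' : HasCompactSupport (ft g)) :
    ‖∫ p : Rn n × Rn n, σ p * ft f p.1 * ft g p.2 * ft k (-(p.1 + p.2))‖ₑ ≤
      (∑' ν, localL2 k ν) * (multNorm ⊤ σ * (eLpNorm f 2 volume * eLpNorm g 2 volume)) := by
  set W : Rn n × Rn n → ℂ := fun p => σ p * ft f p.1 * ft g p.2 with hW
  have hWc : Continuous W :=
    (hσ.mul (hf.comp continuous_fst)).mul (hg.comp continuous_snd)
  have hWs : HasCompactSupport W := by
    refine HasCompactSupport.intro (hf'.isCompact.prod hg'.isCompact) fun p hp => ?_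
    rw [Set.mem_prod, not_and_or] at hp
    rcases hp with h | h
    · simp [hW, image_eq_zero_of_notMem_tsupport h]
    · simp [hW, image_eq_zero_of_notMem_tsupport h]
  have hWi : Integrable W := hWc.integrable_of_hasCompactSupport hWs
  set e : (Rn n × Rn n) × Rn n → ℂ := fun q =>
    cexp ((2 * Real.pi * I) * ((∑ i, q.2 i * (q.1.1 i + q.1.2 i) : ℝ) : ℂ)) with he
  have hec : Continuous e := by simp only [he]; fun_prop
  have hen : ∀ q, ‖e q‖ = 1 := by
    intro q
    simp only [he]
    rw [show (2 * Real.pi * I) * ((∑ i, q.2 i * (q.1.1 i + q.1.2 i) : ℝ) : ℂ) =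
      ((2 * Real.pi * (∑ i, q.2 i * (q.1.1 i + q.1.2 i)) : ℝ) : ℂ) * I by push_cast; ring]
    exact Complex.norm_exp_ofReal_mul_I _
  have hT : ∀ x, Tbil σ f g x = ∫ p, e (p, x) * W p := by
    intro x
    simp only [Tbil, he, hW, mul_assoc]
  have hTm : Measurable (Tbil σ f g) := by
    have hc : Continuous fun q : Rn n × (Rn n × Rn n) => e (q.2, q.1) * W q.2 :=
      (hec.comp (by fun_prop)).mul (hWc.comp continuous_snd)
    have := hc.stronglyMeasurable.integral_prod_right' (ν := (volume : Measure (Rn n × Rn n)))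
    have h2 : Tbil σ f g = fun x => ∫ p, e (p, x) * W p := funext hT
    rw [h2]
    exact this.measurable
  have hswap : ∫ p : Rn n × Rn n, W p * ft k (-(p.1 + p.2)) = ∫ x, k x * Tbil σ f g x := by
    have hint : Integrable (Function.uncurry fun (p : Rn n × Rn n) (x : Rn n) =>
        e (p, x) * (W p * k x)) (volume.prod volume) := by
      refine (hWi.mul_prod (k.integrable)).bdd_mul (c := 1) hec.aestronglyMeasurable ?_
      exact Filter.Eventually.of_forall fun q => (hen q).le
    calc ∫ p : Rn n × Rn n, W p * ft k (-(p.1 + p.2))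
        = ∫ p : Rn n × Rn n, ∫ x, e (p, x) * (W p * k x) := by
          refine integral_congr_ae (Filter.Eventually.of_forall fun p => ?_)
          simp only [ft]
          rw [← integral_const_mul]
          refine integral_congr_ae (Filter.Eventually.of_forall fun x => ?_)
          simp only [he]
          have : (-2 * Real.pi * I) * ((∑ i, x i * (-(p.1 + p.2)) i : ℝ) : ℂ) =
              (2 * Real.pi * I) * ((∑ i, x i * (p.1 i + p.2 i) : ℝ) : ℂ) := by
            simp only [Pi.neg_apply, Pi.add_apply, mul_neg, Finset.sum_neg_distrib, ofReal_neg]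
            ring
          rw [this]
          ring
      _ = ∫ x, ∫ p : Rn n × Rn n, e (p, x) * (W p * k x) := integral_integral_swap hint
      _ = _ := by
          refine integral_congr_ae (Filter.Eventually.of_forall fun x => ?_)
          simp only [hT]
          rw [← integral_const_mul]
          refine integral_congr_ae (Filter.Eventually.of_forall fun p => ?_)
          ring
  rw [hswap]
  calc ‖∫ x, k x * Tbil σ f g x‖ₑ ≤ ∫⁻ x, ‖k x * Tbil σ f g x‖ₑ :=
        enorm_integral_le_lintegral_enorm _
    _ = ∫⁻ x, ‖k x‖ₑ * ‖Tbil σ f g x‖ₑ := by simp_rw [enorm_mul]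
    _ ≤ (∑' ν, localL2 k ν) * amalgamNorm ⊤ (Tbil σ f g) :=
        lintegral_mul_le_amalgamNorm k.continuous.measurable hTm
    _ ≤ _ := by gcongr; exact amalgamNorm_Tbil_le σ f g

theorem coeZ_add {n : ℕ} (μ ν : Zn n) : coeZ (μ + ν) = coeZ μ + coeZ ν := by
  ext i; simp [coeZ]

theorem one_le_norm_coeZ_sub {n : ℕ} {μ ν : Zn n} (h : μ ≠ ν) : 1 ≤ ‖coeZ μ - coeZ ν‖ := by
  obtain ⟨i, hi⟩ := Function.ne_iff.1 h
  refine le_trans ?_ (norm_le_pi_norm (coeZ μ - coeZ ν) i)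
  have : 1 ≤ |μ i - ν i| := Int.one_le_abs (sub_ne_zero.2 hi)
  rw [Real.norm_eq_abs]
  simp only [coeZ, Pi.sub_apply]
  exact_mod_cast this

/-- Testing a multiplier against translates of a tensor product of two narrow bumps gives a matrix
whose trilinear form is controlled by the multiplier norm. -/
theorem exists_enorm_trilinear_bump_le {n : ℕ} {b b' : Rn n → ℂ} {x y : Rn n}
    (hb : ContDiff ℝ (⊤ : ℕ∞) b) (hbs : HasCompactSupport b)
    (hbx : ∀ ξ, b ξ ≠ 0 → ‖ξ - x‖ ≤ 1 / 10)
    (hb' : ContDiff ℝ (⊤ : ℕ∞) b') (hbs' : HasCompactSupport b')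
    (hby : ∀ ξ, b' ξ ≠ 0 → ‖ξ - y‖ ≤ 1 / 10) :
    ∃ C : ℝ≥0∞, C < ∞ ∧ ∀ σ : Rn n × Rn n → ℂ, Continuous σ → ∀ F G H : Zn n →₀ ℂ,
      ∑ μ ∈ F.support, ‖F μ‖ ^ 2 = 1 → ∑ ν ∈ G.support, ‖G ν‖ ^ 2 = 1 →
      ∑ ρ ∈ H.support, ‖H ρ‖ ^ 2 = 1 →
      ‖∑ μ ∈ F.support, ∑ ν ∈ G.support,
        (∫ p : Rn n × Rn n, b (p.1 - coeZ μ) * b' (p.2 - coeZ ν) * σ p) *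
          F μ * G ν * H (μ + ν)‖ₑ ≤ C * multNorm ⊤ σ := by
  let χ : ContDiffBump (-(x + y)) := ⟨1 / 5, 3 / 10, by norm_num, by norm_num⟩
  have hχ : ContDiff ℝ (⊤ : ℕ∞) fun ξ => (χ ξ : ℂ) := ofRealCLM.contDiff.comp χ.contDiff
  have hχs : HasCompactSupport fun ξ => (χ ξ : ℂ) :=
    χ.hasCompactSupport.comp_left (g := fun t : ℝ => (t : ℂ)) ofReal_zero
  obtain ⟨C₁, hC₁, h₁⟩ := exists_schwartz_ft_eq_sum_translate hb hbs
  obtain ⟨C₂, hC₂, h₂⟩ := exists_schwartz_ft_eq_sum_translate hb' hbs'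
  obtain ⟨C₃, hC₃, h₃⟩ := exists_schwartz_ft_eq_sum_translate hχ hχs
  refine ⟨C₃ * (C₁ * C₂), ENNReal.mul_lt_top hC₃ (ENNReal.mul_lt_top hC₁ hC₂), ?_⟩
  intro σ hσ F G H hF hG hH
  obtain ⟨f, hf, hfn⟩ := h₁ F.support F hF
  obtain ⟨g, hg, hgn⟩ := h₂ G.support G hG
  obtain ⟨k, hk, hkn⟩ := h₃ (H.support.map (Equiv.neg (Zn n)).toEmbedding) (fun ρ => H (-ρ))
    (by simpa using hH)
  have htc : ∀ {c : Rn n → ℂ} (hc : Continuous c) (μ : Zn n),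
      Continuous fun ξ => c (ξ - coeZ μ) := fun hc μ => hc.comp (by fun_prop)
  have hts : ∀ {c : Rn n → ℂ} (hc : HasCompactSupport c) (μ : Zn n),
      HasCompactSupport fun ξ => c (ξ - coeZ μ) := fun hc μ =>
    hc.comp_homeomorph (Homeomorph.subRight (coeZ μ))
  have hfc : Continuous (ft f) := by
    rw [funext hf]
    exact continuous_finsetSum _ fun μ _ => continuous_const.mul (htc hb.continuous μ)
  have hgc : Continuous (ft g) := by
    rw [funext hg]
    exact continuous_finsetSum _ fun μ _ => continuous_const.mul (htc hb'.continuous μ)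
  have hfs : HasCompactSupport (ft f) := by
    rw [funext hf]
    exact hasCompactSupport_finsetSum _ fun μ => (hts hbs μ).mul_left
  have hgs : HasCompactSupport (ft g) := by
    rw [funext hg]
    exact hasCompactSupport_finsetSum _ fun μ => (hts hbs' μ).mul_left
  have hkey : ∀ (p : Rn n × Rn n) (μ ν : Zn n), b (p.1 - coeZ μ) ≠ 0 → b' (p.2 - coeZ ν) ≠ 0 →
      ft k (-(p.1 + p.2)) = H (μ + ν) := by
    intro p μ ν hμ hν
    have hd : ‖p.1 + p.2 - coeZ (μ + ν) - (x + y)‖ ≤ 1 / 5 := by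
      have : p.1 + p.2 - coeZ (μ + ν) - (x + y) = (p.1 - coeZ μ - x) + (p.2 - coeZ ν - y) := by
        rw [coeZ_add]; abel
      rw [this]
      refine (norm_add_le _ _).trans ?_
      linarith [hbx _ hμ, hby _ hν]
    rw [hk, Finset.sum_map]
    have hneg : ∀ ρ : Zn n, -(p.1 + p.2) - coeZ (-ρ) = -(p.1 + p.2 - coeZ ρ) := by
      intro ρ
      ext i
      simp [coeZ]
      ring
    have hterm : ∀ ρ ∈ H.support, (H (- -ρ) : ℂ) * ((χ (-(p.1 + p.2) - coeZ (-ρ)) : ℝ) : ℂ) =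
        if ρ = μ + ν then H (μ + ν) else 0 := by
      intro ρ _
      rw [hneg, neg_neg]
      split_ifs with hρ
      · rw [hρ, χ.one_of_mem_closedBall, ofReal_one, mul_one]
        rw [Metric.mem_closedBall, dist_eq_norm, ← norm_neg]
        refine le_trans (le_of_eq ?_) hd
        congr 1
        abel
      · rw [χ.zero_of_le_dist, ofReal_zero, mul_zero]
        change 3 / 10 ≤ _
        have h1 := one_le_norm_coeZ_sub hρ
        rw [dist_eq_norm, ← norm_neg]
        have h2 : coeZ ρ - coeZ (μ + ν) = (p.1 + p.2 - coeZ (μ + ν) - (x + y)) -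
            -(-(p.1 + p.2 - coeZ ρ) - -(x + y)) := by abel
        rw [h2] at h1
        linarith [norm_sub_le (p.1 + p.2 - coeZ (μ + ν) - (x + y))
          (-(-(p.1 + p.2 - coeZ ρ) - -(x + y)))]
    refine (Finset.sum_congr rfl hterm).trans ?_
    rw [Finset.sum_ite_eq']
    split_ifs with h
    · rfl
    · exact (Finsupp.notMem_support_iff.1 h).symm
  have hident : ∑ μ ∈ F.support, ∑ ν ∈ G.support,
        (∫ p : Rn n × Rn n, b (p.1 - coeZ μ) * b' (p.2 - coeZ ν) * σ p) *
          F μ * G ν * H (μ + ν) =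
      ∫ p : Rn n × Rn n, σ p * ft f p.1 * ft g p.2 * ft k (-(p.1 + p.2)) := by
    have hint : ∀ μ ν : Zn n, Integrable fun p : Rn n × Rn n =>
        b (p.1 - coeZ μ) * b' (p.2 - coeZ ν) * σ p * (F μ * G ν * H (μ + ν)) := by
      intro μ ν
      refine (Continuous.integrable_of_hasCompactSupport ?_ ?_).mul_const _
      · exact (((htc hb.continuous μ).comp continuous_fst).mul
          ((htc hb'.continuous ν).comp continuous_snd)).mul hσ
      · refine HasCompactSupport.intro ((hts hbs μ).isCompact.prod (hts hbs' ν).isCompact)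
          fun p hp => ?_
        rw [Set.mem_prod, not_and_or] at hp
        rcases hp with h | h
        · rw [image_eq_zero_of_notMem_tsupport h, zero_mul, zero_mul]
        · rw [image_eq_zero_of_notMem_tsupport h, mul_zero, zero_mul]
    have hpt : ∀ p : Rn n × Rn n, σ p * ft f p.1 * ft g p.2 * ft k (-(p.1 + p.2)) =
        ∑ μ ∈ F.support, ∑ ν ∈ G.support,
          b (p.1 - coeZ μ) * b' (p.2 - coeZ ν) * σ p * (F μ * G ν * H (μ + ν)) := by
      intro p
      rw [hf p.1, hg p.2, mul_assoc (σ p), Finset.sum_mul_sum, Finset.mul_sum, Finset.sum_mul]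
      refine Finset.sum_congr rfl fun μ _ => ?_
      rw [Finset.mul_sum, Finset.sum_mul]
      refine Finset.sum_congr rfl fun ν _ => ?_
      by_cases hμ : b (p.1 - coeZ μ) = 0
      · simp [hμ]
      by_cases hν : b' (p.2 - coeZ ν) = 0
      · simp [hν]
      rw [hkey p μ ν hμ hν]
      ring
    simp_rw [hpt]
    rw [integral_finsetSum _ fun μ _ => integrable_finsetSum _ fun ν _ => hint μ ν]
    refine Finset.sum_congr rfl fun μ _ => ?_
    rw [integral_finsetSum _ fun ν _ => hint μ ν]
    refine Finset.sum_congr rfl fun ν _ => ?_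
    rw [integral_mul_const]
    ring
  rw [hident]
  calc _ ≤ (∑' ν, localL2 k ν) *
        (multNorm ⊤ σ * (eLpNorm f 2 volume * eLpNorm g 2 volume)) :=
        enorm_integral_mul_ft_le hσ f g k hfc hfs hgc hgs
    _ ≤ C₃ * (multNorm ⊤ σ * (C₁ * C₂)) := by
        gcongr
        · exact (eLpNorm_two_le_tsum_localL2 f).trans hfn
        · exact (eLpNorm_two_le_tsum_localL2 g).trans hgn
    _ = _ := by ring

theorem exists_finset_translate_eq_zero {n : ℕ} {Φ : Rn n × Rn n → ℂ} (hΦ : HasCompactSupport Φ)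
    (R : ℝ) : ∃ S : Finset (Zn n × Zn n), ∀ p : Rn n × Rn n, ‖p‖ ≤ R → ∀ α ∉ S,
      Φ (p.1 - coeZ α.1, p.2 - coeZ α.2) = 0 := by
  obtain ⟨R', hR'⟩ := hΦ.isCompact.isBounded.exists_norm_le
  obtain ⟨N, hN⟩ := exists_nat_ge (R + R')
  have hbound : ∀ (x : Rn n) (μ : Zn n), ‖x‖ ≤ R → ‖x - coeZ μ‖ ≤ R' →
      μ ∈ Finset.Icc (fun _ => -(N : ℤ)) (fun _ => (N : ℤ)) := by
    intro x μ hx hμ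
    have h1 : ‖coeZ μ‖ ≤ N := by
      have : coeZ μ = x - (x - coeZ μ) := by abel
      rw [this]
      exact (norm_sub_le _ _).trans (by linarith)
    have h2 : ∀ i, |μ i| ≤ (N : ℤ) := fun i => by
      have := (norm_le_pi_norm (coeZ μ) i).trans h1
      rw [Real.norm_eq_abs, coeZ] at this
      exact_mod_cast this
    exact Finset.mem_Icc.2 ⟨fun i => (abs_le.1 (h2 i)).1, fun i => (abs_le.1 (h2 i)).2⟩
  refine ⟨Finset.Icc (fun _ => -(N : ℤ)) (fun _ => (N : ℤ)) ×ˢ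
    Finset.Icc (fun _ => -(N : ℤ)) (fun _ => (N : ℤ)), fun p hp α hα => ?_⟩
  by_contra hne
  have h := hR' _ (subset_tsupport Φ hne)
  refine hα (Finset.mem_product.2 ⟨hbound p.1 _ ?_ ?_, hbound p.2 _ ?_ ?_⟩)
  · exact (norm_fst_le p).trans hp
  · exact (norm_fst_le (p.1 - coeZ α.1, p.2 - coeZ α.2)).trans h
  · exact (norm_snd_le p).trans hp
  · exact (norm_snd_le (p.1 - coeZ α.1, p.2 - coeZ α.2)).trans h

theorem continuous_translate {n : ℕ} {Φ : Rn n × Rn n → ℂ} (hΦ : Continuous Φ)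
    (α : Zn n × Zn n) :
    Continuous fun p : Rn n × Rn n => Φ (p.1 - coeZ α.1, p.2 - coeZ α.2) :=
  hΦ.comp (by fun_prop)

theorem continuous_sigmaA {n : ℕ} {Φ : Rn n × Rn n → ℂ} (hΦ : Continuous Φ)
    (hΦ' : HasCompactSupport Φ) (A : Zn n → Zn n → ℂ) : Continuous (sigmaA A Φ) := by
  refine continuous_iff_continuousAt.2 fun p₀ => ?_
  obtain ⟨S, hS⟩ := exists_finset_translate_eq_zero hΦ' (‖p₀‖ + 1)
  have hc : Continuous fun p : Rn n × Rn n =>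
      ∑ α ∈ S, A α.1 α.2 * Φ (p.1 - coeZ α.1, p.2 - coeZ α.2) :=
    continuous_finsetSum _ fun α _ => continuous_const.mul (continuous_translate hΦ α)
  refine hc.continuousAt.congr ?_
  filter_upwards [Metric.ball_mem_nhds p₀ one_pos] with p hp
  refine (tsum_eq_sum fun α hα => ?_).symm
  rw [hS p _ α hα, mul_zero]
  have : p = p₀ + (p - p₀) := by abel
  rw [this]
  refine (norm_add_le _ _).trans ?_
  rw [Metric.mem_ball, dist_eq_norm] at hp
  gcongr

/-- Testing `σ_{A,Φ}` against a compactly supported function gives a finite combination of the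
entries of `A`. -/
theorem exists_finsupp_integral_mul_sigmaA {n : ℕ} {Φ Ξ : Rn n × Rn n → ℂ} (hΦ : Continuous Φ)
    (hΦ' : HasCompactSupport Φ) (hΞ : Continuous Ξ) (hΞ' : HasCompactSupport Ξ) :
    ∃ v : Zn n × Zn n →₀ ℂ,
      (∀ α, v α = ∫ p : Rn n × Rn n, Ξ p * Φ (p.1 - coeZ α.1, p.2 - coeZ α.2)) ∧
      ∀ A : Zn n → Zn n → ℂ,
        ∫ p, Ξ p * sigmaA A Φ p = v.sum fun α c => c * A α.1 α.2 := by
  obtain ⟨R, hR⟩ := hΞ'.isCompact.isBounded.exists_norm_le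
  obtain ⟨S, hS⟩ := exists_finset_translate_eq_zero hΦ' R
  have hzero : ∀ p, ∀ α ∉ S, Ξ p * Φ (p.1 - coeZ α.1, p.2 - coeZ α.2) = 0 := by
    intro p α hα
    by_cases hp : Ξ p = 0
    · rw [hp, zero_mul]
    · rw [hS p (hR p (subset_tsupport Ξ hp)) α hα, mul_zero]
  refine ⟨Finsupp.onFinset S
    (fun α => ∫ p : Rn n × Rn n, Ξ p * Φ (p.1 - coeZ α.1, p.2 - coeZ α.2)) ?_, fun α => rfl, ?_⟩
  · intro α hα
    by_contra h
    exact hα (by simp only [hzero _ α h, integral_zero])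
  · intro A
    rw [Finsupp.onFinset_sum _ (by simp)]
    have hpt : ∀ p, Ξ p * sigmaA A Φ p =
        ∑ α ∈ S, Ξ p * Φ (p.1 - coeZ α.1, p.2 - coeZ α.2) * A α.1 α.2 := by
      intro p
      rw [sigmaA, ← tsum_mul_left, tsum_eq_sum (s := S)]
      · exact Finset.sum_congr rfl fun α _ => by ring
      · intro α hα
        linear_combination A α.1 α.2 * hzero p α hα
    simp_rw [hpt]
    rw [integral_finsetSum]
    · exact Finset.sum_congr rfl fun α _ => integral_mul_const _ _
    · intro α _
      exact ((hΞ.mul (continuous_translate hΦ α)).integrable_of_hasCompactSupport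
        hΞ'.mul_right).mul_const _

theorem sigmaA_add_coeZ {n : ℕ} (A : Zn n → Zn n → ℂ) (Φ : Rn n × Rn n → ℂ) (μ ν : Zn n)
    (p : Rn n × Rn n) :
    sigmaA A Φ (p + (coeZ μ, coeZ ν)) = sigmaA (fun α β => A (α + μ) (β + ν)) Φ p := by
  rw [sigmaA, sigmaA, ← (Equiv.addRight ((μ, ν) : Zn n × Zn n)).tsum_eq]
  refine tsum_congr fun α => ?_
  simp [coeZ_add]

/-- A continuous function on the product space annihilated by all tensor products of narrow bumps
vanishes. -/
theorem eq_zero_of_integral_bump_mul_eq_zero {n : ℕ} {σ : Rn n × Rn n → ℂ} (hσ : Continuous σ)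
    (h : ∀ (x y : Rn n) (b : ContDiffBump x) (b' : ContDiffBump y), b.rOut ≤ 1 / 10 →
      b'.rOut ≤ 1 / 10 → ∫ p : Rn n × Rn n, (b p.1 : ℂ) * (b' p.2 : ℂ) * σ p = 0) : σ = 0 := by
  by_contra hne
  obtain ⟨p₀, hp₀⟩ := Function.ne_iff.1 hne
  set w : Rn n × Rn n → ℝ := fun p => ((starRingEnd ℂ) (σ p₀) * σ p).re with hw
  have hwc : Continuous w := by simp only [hw]; fun_prop
  have hw0 : 0 < w p₀ := by
    simp only [hw]
    rw [mul_comm, Complex.mul_conj, ofReal_re]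
    exact Complex.normSq_pos.2 hp₀
  obtain ⟨δ, hδ, hball⟩ := Metric.mem_nhds_iff.1 (hwc.continuousAt.eventually (lt_mem_nhds hw0))
  set r := min δ (1 / 10) with hr
  have hr0 : 0 < r := lt_min hδ (by norm_num)
  let b : ContDiffBump p₀.1 := ⟨r / 2, r, by positivity, by linarith⟩
  let b' : ContDiffBump p₀.2 := ⟨r / 2, r, by positivity, by linarith⟩
  have hbc : Continuous fun p : Rn n × Rn n => b p.1 * b' p.2 :=
    (b.continuous.comp continuous_fst).mul (b'.continuous.comp continuous_snd)
  have hcs : HasCompactSupport fun p : Rn n × Rn n => b p.1 * b' p.2 := by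
    refine HasCompactSupport.intro (b.hasCompactSupport.isCompact.prod
      b'.hasCompactSupport.isCompact) fun p hp => ?_
    rw [Set.mem_prod, not_and_or] at hp
    rcases hp with h | h
    · rw [image_eq_zero_of_notMem_tsupport h, zero_mul]
    · rw [image_eq_zero_of_notMem_tsupport h, mul_zero]
  have hpos : 0 < ∫ p : Rn n × Rn n, b p.1 * b' p.2 * w p := by
    refine (hbc.mul hwc).integral_pos_of_hasCompactSupport_nonneg_nonzero hcs.mul_right ?_
      (x := p₀) ?_
    · intro p
      simp only [Pi.zero_apply]
      by_cases h1 : b p.1 = 0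
      · simp [h1]
      by_cases h2 : b' p.2 = 0
      · simp [h2]
      refine mul_nonneg (mul_nonneg b.nonneg b'.nonneg) (le_of_lt (hball ?_))
      have h1' : dist p.1 p₀.1 < r := lt_of_not_ge fun h => h1 (b.zero_of_le_dist h)
      have h2' : dist p.2 p₀.2 < r := lt_of_not_ge fun h => h2 (b'.zero_of_le_dist h)
      rw [Metric.mem_ball, Prod.dist_eq]
      exact max_lt (h1'.trans_le (min_le_left _ _)) (h2'.trans_le (min_le_left _ _))
    · have h1 : b p₀.1 = 1 := b.one_of_mem_closedBall (Metric.mem_closedBall_self (by positivity))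
      have h2 : b' p₀.2 = 1 := b'.one_of_mem_closedBall (Metric.mem_closedBall_self (by positivity))
      simp only [h1, h2, one_mul]
      exact hw0.ne'
  refine hpos.ne' ?_
  have hcont : Continuous fun p : Rn n × Rn n => ((b p.1 * b' p.2 : ℝ) : ℂ) * σ p :=
    (continuous_ofReal.comp hbc).mul hσ
  have hcs' : HasCompactSupport fun p : Rn n × Rn n => ((b p.1 * b' p.2 : ℝ) : ℂ) * σ p :=
    (hcs.comp_left (g := fun t : ℝ => (t : ℂ)) ofReal_zero).mul_right
  have hi : Integrable fun p : Rn n × Rn n =>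
      (starRingEnd ℂ) (σ p₀) * (((b p.1 * b' p.2 : ℝ) : ℂ) * σ p) :=
    (hcont.integrable_of_hasCompactSupport hcs').const_mul _
  have hre := reCLM.integral_comp_comm hi
  have h0 := h p₀.1 p₀.2 b b' (min_le_right _ _) (min_le_right _ _)
  rw [integral_const_mul] at hre
  simp only [ofReal_mul, h0, mul_zero, map_zero] at hre
  rw [← hre]
  refine integral_congr_ae (Filter.Eventually.of_forall fun p => ?_)
  simp only [hw, reCLM_apply]
  rw [← re_ofReal_mul]
  congr 1
  push_cast
  ring

/-- The trilinear form obtained by averaging translates of `A` with finitely supported weights `v`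
is controlled by the multiplier norm of `σ_{A,Φ}`. -/
def ControlledWeights {n : ℕ} (Φ : Rn n × Rn n → ℂ) (v : Zn n × Zn n →₀ ℂ) : Prop :=
  ∃ C : ℝ≥0∞, C < ∞ ∧ ∀ (A : Zn n → Zn n → ℂ) (F G H : Zn n →₀ ℂ),
    ∑ μ ∈ F.support, ‖F μ‖ ^ 2 = 1 → ∑ ν ∈ G.support, ‖G ν‖ ^ 2 = 1 →
    ∑ ρ ∈ H.support, ‖H ρ‖ ^ 2 = 1 →
    ‖∑ μ ∈ F.support, ∑ ν ∈ G.support, (v.sum fun α c => c * A (α.1 + μ) (α.2 + ν)) *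
      F μ * G ν * H (μ + ν)‖ₑ ≤ C * multNorm ⊤ (sigmaA A Φ)

/-- The weights produced by testing `Φ` against a tensor product of narrow bumps. -/
def IsBumpWeights {n : ℕ} (Φ : Rn n × Rn n → ℂ) (v : Zn n × Zn n →₀ ℂ) : Prop :=
  ∃ (x y : Rn n) (b : ContDiffBump x) (b' : ContDiffBump y), b.rOut ≤ 1 / 10 ∧ b'.rOut ≤ 1 / 10 ∧
    ∀ A : Zn n → Zn n → ℂ, ∫ p : Rn n × Rn n, (b p.1 : ℂ) * (b' p.2 : ℂ) * sigmaA A Φ p =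
      v.sum fun α c => c * A α.1 α.2

theorem IsBumpWeights.controlledWeights {n : ℕ} {Φ : Rn n × Rn n → ℂ} (hΦ : Continuous Φ)
    (hΦ' : HasCompactSupport Φ) {v : Zn n × Zn n →₀ ℂ} (hv : IsBumpWeights Φ v) :
    ControlledWeights Φ v := by
  obtain ⟨x, y, b, b', hb, hb', h⟩ := hv
  have hsupp : ∀ {z : Rn n} (c : ContDiffBump z), c.rOut ≤ 1 / 10 →
      ∀ ξ, (c ξ : ℂ) ≠ 0 → ‖ξ - z‖ ≤ 1 / 10 := by
    intro z c hc ξ hξ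
    rw [← dist_eq_norm]
    by_contra hlt
    exact hξ (by rw [c.zero_of_le_dist (by linarith), ofReal_zero])
  obtain ⟨C, hC, hmain⟩ := exists_enorm_trilinear_bump_le
    (b := fun ξ => (b ξ : ℂ)) (b' := fun ξ => (b' ξ : ℂ))
    (ofRealCLM.contDiff.comp b.contDiff)
    (b.hasCompactSupport.comp_left (g := fun t : ℝ => (t : ℂ)) ofReal_zero) (hsupp b hb)
    (ofRealCLM.contDiff.comp b'.contDiff)
    (b'.hasCompactSupport.comp_left (g := fun t : ℝ => (t : ℂ)) ofReal_zero) (hsupp b' hb')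
  refine ⟨C, hC, fun A F G H hF hG hH => ?_⟩
  refine le_of_eq_of_le ?_ (hmain _ (continuous_sigmaA hΦ hΦ' A) F G H hF hG hH)
  congr 1
  refine Finset.sum_congr rfl fun μ _ => Finset.sum_congr rfl fun ν _ => ?_
  have : (volume : Measure (Rn n × Rn n)).IsAddRightInvariant :=
    inferInstanceAs ((volume : Measure (Rn n)).prod (volume : Measure (Rn n))).IsAddRightInvariant
  have hshift := integral_add_right_eq_self (μ := (volume : Measure (Rn n × Rn n)))
    (fun p => (b (p.1 - coeZ μ) : ℂ) * (b' (p.2 - coeZ ν) : ℂ) * sigmaA A Φ p) (coeZ μ, coeZ ν)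
  rw [← h fun α β => A (α + μ) (β + ν), ← hshift]
  simp only [← sigmaA_add_coeZ, Prod.fst_add, Prod.snd_add, add_sub_cancel_right]

theorem controlledWeights_of_mem_span {n : ℕ} {Φ : Rn n × Rn n → ℂ} (hΦ : Continuous Φ)
    (hΦ' : HasCompactSupport Φ) {v : Zn n × Zn n →₀ ℂ}
    (hv : v ∈ Submodule.span ℂ {v | IsBumpWeights Φ v}) : ControlledWeights Φ v := by
  induction hv using Submodule.span_induction with
  | mem v hv => exact IsBumpWeights.controlledWeights hΦ hΦ' hv
  | zero => exact ⟨0, ENNReal.zero_lt_top, fun A F G H _ _ _ => by simp⟩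
  | add v w _ _ hv hw =>
    obtain ⟨C, hC, hv⟩ := hv
    obtain ⟨D, hD, hw⟩ := hw
    refine ⟨C + D, ENNReal.add_lt_top.2 ⟨hC, hD⟩, fun A F G H hF hG hH => ?_⟩
    have hsum : ∀ μ ν : Zn n, ((v + w).sum fun α c => c * A (α.1 + μ) (α.2 + ν)) =
        (v.sum fun α c => c * A (α.1 + μ) (α.2 + ν)) +
          w.sum fun α c => c * A (α.1 + μ) (α.2 + ν) := fun μ ν =>
      Finsupp.sum_add_index' (by simp) fun _ _ _ => add_mul _ _ _
    simp_rw [hsum, add_mul, Finset.sum_add_distrib]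
    exact (enorm_add_le _ _).trans (add_le_add (hv A F G H hF hG hH) (hw A F G H hF hG hH))
  | smul c v _ hv =>
    obtain ⟨C, hC, hv⟩ := hv
    refine ⟨‖c‖ₑ * C, ENNReal.mul_lt_top enorm_lt_top hC, fun A F G H hF hG hH => ?_⟩
    have hsum : ∀ μ ν : Zn n, ((c • v).sum fun α c => c * A (α.1 + μ) (α.2 + ν)) =
        c * v.sum fun α c => c * A (α.1 + μ) (α.2 + ν) := by
      intro μ ν
      rw [Finsupp.sum_smul_index' (by simp), Finsupp.mul_sum]
      simp only [smul_eq_mul, mul_assoc]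
    simp_rw [hsum, mul_assoc c, ← Finset.mul_sum, enorm_mul, mul_assoc]
    gcongr
    simpa only [mul_assoc] using hv A F G H hF hG hH

/-- Under condition (A), the unit weight at the origin is a combination of bump weights. -/
theorem single_mem_span_isBumpWeights {n : ℕ} {Φ : Rn n × Rn n → ℂ} (hΦ : Continuous Φ)
    (hΦ' : HasCompactSupport Φ) (hA : ConditionA2 Φ) :
    Finsupp.single (0 : Zn n × Zn n) (1 : ℂ) ∈ Submodule.span ℂ {v | IsBumpWeights Φ v} := by
  by_contra hmem
  obtain ⟨ℓ, hℓ, hker⟩ := Submodule.exists_le_ker_of_notMem hmem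
  set A : Zn n → Zn n → ℂ := fun α β => ℓ (Finsupp.single (α, β) 1) with hAdef
  have hsum : ∀ v : Zn n × Zn n →₀ ℂ, (v.sum fun α c => c * A α.1 α.2) = ℓ v := by
    intro v
    conv_rhs => rw [← Finsupp.sum_single v]
    rw [map_finsuppSum]
    refine Finsupp.sum_congr fun α _ => ?_
    rw [← mul_one (v α), ← smul_eq_mul (v α) 1, ← Finsupp.smul_single, map_smul]
    simp [hAdef]
  have hσ : sigmaA A Φ = 0 := by
    refine eq_zero_of_integral_bump_mul_eq_zero (continuous_sigmaA hΦ hΦ' A) ?_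
    intro x y b b' hb hb'
    obtain ⟨v, -, hv⟩ := exists_finsupp_integral_mul_sigmaA hΦ hΦ'
      (Ξ := fun p => (b p.1 : ℂ) * (b' p.2 : ℂ))
      ((continuous_ofReal.comp (b.continuous.comp continuous_fst)).mul
        (continuous_ofReal.comp (b'.continuous.comp continuous_snd)))
      (HasCompactSupport.intro (b.hasCompactSupport.isCompact.prod
        b'.hasCompactSupport.isCompact) fun p hp => by
          rw [Set.mem_prod, not_and_or] at hp
          rcases hp with h | h
          · rw [image_eq_zero_of_notMem_tsupport h, ofReal_zero, zero_mul]
          · rw [image_eq_zero_of_notMem_tsupport h, ofReal_zero, mul_zero])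
    rw [hv, hsum]
    exact hker (Submodule.subset_span ⟨x, y, b, b', hb, hb', hv⟩)
  obtain ⟨Θ, hΘ, hΘ', hdual⟩ := hA
  obtain ⟨v, hv, hvA⟩ := exists_finsupp_integral_mul_sigmaA hΦ hΦ' hΘ.continuous hΘ'
  have hv0 : v = Finsupp.single 0 1 := by
    ext α
    rw [hv, hdual, Finsupp.single_apply]
    exact if_congr (by rw [eq_comm (a := 0), Prod.ext_iff]; rfl) rfl rfl
  refine hℓ ?_
  rw [← hv0, ← hsum, ← hvA, hσ]
  simp

/-- If `Φ ∈ C_c^∞(ℝ^n × ℝ^n)` satisfies condition (A), then there exists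
`c ∈ (0,∞)` depending only on `n` and `Φ` such that
`‖σ_{A,Φ}‖_{M(L²×L² → (L²,ℓ^∞))} ≥ c⁻¹ ‖A‖_B` for all `L^∞` matrices `A`. -/
theorem statement1 (n : ℕ) (Φ : Rn n × Rn n → ℂ) (hΦ : IsCcInfty Φ) (hcondA : ConditionA2 Φ) :
    ∃ c : ℝ≥0∞, 0 < c ∧ c < ∞ ∧
      ∀ A : Zn n → Zn n → ℂ, IsLinftyMatrix A →
        c⁻¹ * normB A ≤ multNorm ⊤ (sigmaA A Φ) := by
  obtain ⟨C, hC, h⟩ := controlledWeights_of_mem_span hΦ.1.continuous hΦ.2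
    (single_mem_span_isBumpWeights hΦ.1.continuous hΦ.2 hcondA)
  refine ⟨C + 1, by positivity, ENNReal.add_lt_top.2 ⟨hC, ENNReal.one_lt_top⟩, fun A _ => ?_⟩
  rw [ENNReal.inv_mul_le_iff (by positivity) (ENNReal.add_lt_top.2 ⟨hC, ENNReal.one_lt_top⟩).ne]
  refine iSup_le fun F => iSup_le fun G => iSup_le fun H => iSup_le fun hF => iSup_le fun hG =>
    iSup_le fun hH => ?_
  have hFGH := h A F G H hF hG hH
  simp only [zero_mul, Finsupp.sum_single_index, one_mul, Prod.fst_zero, Prod.snd_zero,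
    zero_add] at hFGH
  exact hFGH.trans (by gcongr; exact le_self_add)
end
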